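/- arXiv:1211.4562 — 3 statements merged into one kernel-verified Lean document; each statement's English description precedes it below -/
import Mathlib

section
/- Let A be a central essential arrangement whose Orlik-Terao ideal I(A) ⊆ K[y_1,...,y_n] is a complete intersection generated by quadrics. Then every rank-2 flat of A contains at most 3 hyperplanes, and the number of rank-2 flats containing exactly 3 hyperplanes equals n - ℓ, where ℓ is the rank of A. -/
open MvPolynomial

variable {K : Type*} [Field K] {n ℓ : ℕ}

/-- The rational function field `K(V)` of `V = K^ℓ`. -/
abbrev RatFunField (K : Type*) [Field K] (ℓ : ℕ) :=
  FractionRing (MvPolynomial (Fin ℓ) K)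

/-- The map `K[y_i : i ∈ ι] → K(V)` sending `y_i` to `1/f_i`. -/
noncomputable def otMap {ι : Type*} (f : ι → MvPolynomial (Fin ℓ) K) :
    MvPolynomial ι K →ₐ[K] RatFunField K ℓ :=
  MvPolynomial.aeval fun i =>
    (algebraMap (MvPolynomial (Fin ℓ) K) (RatFunField K ℓ) (f i))⁻¹

/-- The Orlik–Terao ideal `I(A)`: the kernel of `y_i ↦ 1/f_i`. -/
noncomputable def otIdeal {ι : Type*} (f : ι → MvPolynomial (Fin ℓ) K) :
    Ideal (MvPolynomial ι K) :=
  RingHom.ker (otMap f).toRingHom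

/-- An ideal is a complete intersection if it is generated by a regular
sequence. -/
def IsCIdeal {R : Type*} [CommRing R] (I : Ideal R) : Prop :=
  ∃ L : List R, RingTheory.Sequence.IsRegular R L ∧ I = Ideal.span {p | p ∈ L}

/-- An ideal of a polynomial ring is a quadratic complete intersection if it is
generated by a regular sequence of quadrics. -/
def IsQuadCIdeal {ι : Type*} (I : Ideal (MvPolynomial ι K)) : Prop :=
  ∃ L : List (MvPolynomial ι K), RingTheory.Sequence.IsRegular (MvPolynomial ι K) L ∧
    (∀ p ∈ L, p.IsHomogeneous 2) ∧ I = Ideal.span {p | p ∈ L}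

/-- A rank-2 flat of the arrangement: a closed set of hyperplanes spanning a
rank-2 subspace. -/
def IsRank2Flat (f : Fin n → MvPolynomial (Fin ℓ) K) (X : Finset (Fin n)) : Prop :=
  Module.finrank K (Submodule.span K (f '' ↑X)) = 2 ∧
  ∀ i : Fin n, f i ∈ Submodule.span K (f '' ↑X) → i ∈ X

section Specialization

variable {ι : Type*} {F : Type*} [Field F] [Algebra K F]

/-- Relations among the inverses `1/f_i` in `K(V)` persist under every specialization of the
coordinates which keeps the nonzero `f_i` nonzero. -/
lemma aeval_inv_eq_zero_of_mem_otIdeal {f : ι → MvPolynomial (Fin ℓ) K}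
    {q : MvPolynomial ι K} (hq : q ∈ otIdeal f) (ψ : MvPolynomial (Fin ℓ) K →ₐ[K] F)
    (hψ : ∀ i, f i ≠ 0 → ψ (f i) ≠ 0) :
    aeval (fun i => (ψ (f i))⁻¹) q = 0 := by
  classical
  let P : Ideal (MvPolynomial (Fin ℓ) K) := RingHom.ker ψ
  have : P.IsPrime := RingHom.ker_isPrime _
  have hunit : ∀ y : P.primeCompl, IsUnit (ψ y) := fun y =>
    isUnit_iff_ne_zero.mpr fun h => y.2 h
  let φ : Localization.AtPrime P →ₐ[K] F :=
    IsLocalization.liftAlgHom (M := P.primeCompl) (f := ψ) hunit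
  have hle : P.primeCompl ≤ nonZeroDivisors (MvPolynomial (Fin ℓ) K) :=
    P.primeCompl_le_nonZeroDivisors
  let θ : Localization.AtPrime P →ₐ[K] RatFunField K ℓ :=
    IsLocalization.liftAlgHom (M := P.primeCompl)
      (f := IsScalarTower.toAlgHom K (MvPolynomial (Fin ℓ) K) (RatFunField K ℓ))
      fun y => by
        simpa using nonZeroDivisors.ne_zero (hle y.2)
  have hθ : Function.Injective θ := by
    have := (IsLocalization.lift_injective_iff (M := P.primeCompl)
      (S := Localization.AtPrime P)
      (g := algebraMap (MvPolynomial (Fin ℓ) K) (RatFunField K ℓ))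
      (hg := fun y => by simpa using nonZeroDivisors.ne_zero (hle y.2))).2 fun x y => by
        rw [(IsLocalization.injective (Localization.AtPrime P) hle).eq_iff,
          (IsFractionRing.injective (MvPolynomial (Fin ℓ) K) (RatFunField K ℓ)).eq_iff]
    exact this
  let a : ι → Localization.AtPrime P := fun i =>
    if h : f i = 0 then 0 else
      IsLocalization.mk' (M := P.primeCompl) _ 1 ⟨f i, fun h' => hψ i h h'⟩
  have haθ : ∀ i, θ (a i) = (algebraMap _ (RatFunField K ℓ) (f i))⁻¹ := by
    intro i
    by_cases h : f i = 0
    · simp [a, h]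
    · simp [a, h, θ, IsLocalization.lift_mk'_spec]
  have haφ : ∀ i, φ (a i) = (ψ (f i))⁻¹ := by
    intro i
    by_cases h : f i = 0
    · simp [a, h]
    · simp [a, h, φ, IsLocalization.lift_mk'_spec, hψ i h]
  have h0 : aeval a q = 0 := by
    apply hθ
    have : otMap f q = 0 := hq
    rw [map_zero, ← this, otMap, comp_aeval_apply]
    simp only [haθ]
  have := congrArg φ h0
  rw [map_zero, comp_aeval_apply] at this
  simpa only [haφ] using this

/-- A linear form is additive in its argument. -/
lemma aeval_add_mul_of_isHomogeneous_one {A : Type*} [CommRing A] [Algebra K A]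
    {p : MvPolynomial (Fin ℓ) K} (hp : p.IsHomogeneous 1) (w : Fin ℓ → A) (c : A)
    (v : Fin ℓ → K) :
    aeval (fun i => w i + c * algebraMap K A (v i)) p
      = aeval w p + c * algebraMap K A (aeval v p) := by
  rw [← mem_homogeneousSubmodule, homogeneousSubmodule_one_eq_span_X] at hp
  induction hp using Submodule.span_induction with
  | mem x hx => obtain ⟨i, rfl⟩ := hx; simp
  | zero => simp
  | add x y _ _ hx hy => simp only [map_add, hx, hy]; ring
  | smul r x _ hx =>
    rw [map_smul, map_smul, map_smul, hx, smul_eq_mul, map_mul, Algebra.smul_def,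
      Algebra.smul_def]
    ring

/-- Localization of Orlik–Terao relations at the hyperplanes through a point `v`. -/
lemma aeval_localization_eq_zero_of_mem_otIdeal {f : ι → MvPolynomial (Fin ℓ) K}
    (hhom : ∀ i, (f i).IsHomogeneous 1) {q : MvPolynomial ι K} (hq : q ∈ otIdeal f)
    (v : Fin ℓ → K) (w : Fin ℓ → F) (hw : ∀ i, f i ≠ 0 → aeval w (f i) ≠ 0)
    {y : ι → F} (hy : ∀ i, aeval v (f i) = 0 → y i = (aeval w (f i))⁻¹)
    (hy' : ∀ i, aeval v (f i) ≠ 0 → y i = 0) :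
    aeval y q = 0 := by
  classical
  let E := FractionRing (PowerSeries F)
  let c : E := (algebraMap (PowerSeries F) E PowerSeries.X)⁻¹
  let ψ : MvPolynomial (Fin ℓ) K →ₐ[K] E :=
    aeval fun i => algebraMap F E (w i) + c * algebraMap K E (v i)
  have hX : algebraMap (PowerSeries F) E PowerSeries.X ≠ 0 := by
    simp [PowerSeries.X_ne_zero]
  obtain ⟨l, hl⟩ : ∃ l : ι → F, ∀ i, aeval w (f i) = l i := ⟨_, fun _ => rfl⟩
  obtain ⟨m, hm⟩ : ∃ m : ι → K, ∀ i, aeval v (f i) = m i := ⟨_, fun _ => rfl⟩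
  simp only [hl, hm] at hw hy hy'
  have hψ : ∀ i, ψ (f i) = algebraMap F E (l i) + c * algebraMap K E (m i) := by
    intro i
    have h1 : aeval (fun i => algebraMap F E (w i)) (f i) = algebraMap F E (aeval w (f i)) :=
      aeval_algebraMap_apply _ _ _
    simp only [ψ]
    rw [aeval_add_mul_of_isHomogeneous_one (hhom i), h1, hl, hm]
  let d : ι → PowerSeries F := fun i =>
    PowerSeries.C (algebraMap K F (m i)) + PowerSeries.X * PowerSeries.C (l i)
  have hd : ∀ i, algebraMap (PowerSeries F) E (d i)
      = algebraMap (PowerSeries F) E PowerSeries.X * ψ (f i) := by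
    intro i
    have h1 : algebraMap (PowerSeries F) E (PowerSeries.C (l i)) = algebraMap F E (l i) :=
      (IsScalarTower.algebraMap_apply F (PowerSeries F) E (l i)).symm
    have h2 : algebraMap (PowerSeries F) E (PowerSeries.C (algebraMap K F (m i)))
        = algebraMap K E (m i) :=
      by
      rw [IsScalarTower.algebraMap_apply K F E, IsScalarTower.algebraMap_apply F (PowerSeries F) E]
      rfl
    rw [hψ, mul_add, mul_inv_cancel_left₀ hX, map_add, map_mul, h1, h2, add_comm]
  let b : ι → PowerSeries F := fun i =>
    if m i = 0 then PowerSeries.C (l i)⁻¹ else PowerSeries.X * (d i)⁻¹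
  have hb : ∀ i, algebraMap (PowerSeries F) E (b i) = (ψ (f i))⁻¹ := by
    intro i
    by_cases h : m i = 0
    · have h1 : algebraMap (PowerSeries F) E (PowerSeries.C (l i)⁻¹) = algebraMap F E (l i)⁻¹ :=
        (IsScalarTower.algebraMap_apply F (PowerSeries F) E _).symm
      simp only [b, if_pos h, hψ, h, map_zero, mul_zero, add_zero, h1, map_inv₀]
    · have h1 : d i * (d i)⁻¹ = 1 := PowerSeries.mul_inv_cancel _ (by simpa [d] using h)
      have h2 := congrArg (algebraMap (PowerSeries F) E) h1
      rw [map_mul, map_one, hd] at h2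
      simp only [b, if_neg h, map_mul]
      exact eq_inv_of_mul_eq_one_left (by rw [← h2]; ring)
  have hne : ∀ i, f i ≠ 0 → ψ (f i) ≠ 0 := by
    intro i hi h
    have h2 : d i = 0 := by
      apply IsFractionRing.injective (PowerSeries F) E
      rw [hd, h, mul_zero, map_zero]
    have h3 := congrArg (PowerSeries.coeff 1) h2
    simp only [d, mul_comm PowerSeries.X, map_add, PowerSeries.coeff_C_mul, PowerSeries.coeff_C,
      map_zero] at h3
    simp at h3
    exact hw i hi h3
  have h0 := aeval_inv_eq_zero_of_mem_otIdeal hq ψ hne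
  have h1 : aeval b q = 0 := by
    apply IsFractionRing.injective (PowerSeries F) E
    simp only [← hb] at h0
    rw [map_zero, ← h0]
    exact (aeval_algebraMap_apply _ _ _).symm
  let ev : PowerSeries F →ₐ[K] F :=
    { PowerSeries.constantCoeff (R := F) with
      commutes' := fun r => by simp [PowerSeries.algebraMap_apply] }
  have h2 := congrArg ev h1
  rw [map_zero, comp_aeval_apply] at h2
  convert! h2 using 4 with i
  by_cases h : m i = 0
  · simp [ev, b, h, hy]
  · simp [ev, b, h, hy']

end Specialization

section Generic

/-- A point `v` lying on exactly those hyperplanes `f_i = 0` whose equation belongs to a given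
space `W` of polynomials. -/
lemma exists_aeval_eq_zero_iff_mem [Infinite K] {ι : Type*} [Finite ι]
    {f : ι → MvPolynomial (Fin ℓ) K} (hhom : ∀ i, (f i).IsHomogeneous 1)
    (W : Submodule K (MvPolynomial (Fin ℓ) K)) :
    ∃ v : Fin ℓ → K, ∀ i, aeval v (f i) = 0 ↔ f i ∈ W := by
  have key : ∀ (θ : Module.Dual K (MvPolynomial (Fin ℓ) K)) i,
      aeval (fun m => θ (X m)) (f i) = θ (f i) := by
    intro θ i
    have hp := hhom i
    generalize f i = p at hp ⊢
    rw [← mem_homogeneousSubmodule, homogeneousSubmodule_one_eq_span_X] at hp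
    induction hp using Submodule.span_induction with
    | mem x hx => obtain ⟨i, rfl⟩ := hx; simp
    | zero => simp
    | add x y _ _ hx hy => simp only [map_add, hx, hy]
    | smul r x _ hx => simp only [map_smul, hx]
  obtain ⟨θ, hθ, hθ'⟩ := Module.Dual.exists_forall_mem_ne_zero_of_forall_exists
    W.dualAnnihilator
    (fun i : {i // f i ∉ W} => Module.Dual.eval K (MvPolynomial (Fin ℓ) K) (f i)) fun i => by
      obtain ⟨θ, h1, h2⟩ := Submodule.exists_le_ker_of_notMem i.2
      exact ⟨θ, (Submodule.mem_dualAnnihilator _).2 fun w hw => h2 hw, h1⟩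
  refine ⟨fun m => θ (X m), fun i => ?_⟩
  rw [key]
  refine ⟨fun h => ?_, fun h => (Submodule.mem_dualAnnihilator _).1 hθ _ h⟩
  by_contra hi
  exact hθ' ⟨i, hi⟩ h

end Generic

section Dimension

open RingTheory.Sequence in
/-- Each element of a weakly regular sequence lowers the dimension of the support. -/
lemma supportDim_add_length_le_of_isWeaklyRegular {R : Type*} [CommRing R] {M : Type*}
    [AddCommGroup M] [Module R M] [IsNoetherianRing R] [Module.Finite R M] (rs : List R)
    (reg : IsWeaklyRegular M rs) :
    Module.supportDim R (M ⧸ Ideal.ofList rs • (⊤ : Submodule R M)) + rs.length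
      ≤ Module.supportDim R M := by
  induction rs generalizing M with
  | nil =>
    rw [Ideal.ofList_nil, Submodule.bot_smul]
    simpa using (Module.supportDim_eq_of_equiv (Submodule.quotEquivOfEqBot ⊥ rfl)).le
  | cons x rs ih =>
    rw [isWeaklyRegular_cons_iff] at reg
    have h1 := Module.supportDim_quotSMulTop_succ_le_of_notMem_minimalPrimes (M := M) (x := x)
      fun _ => reg.1.notMem_of_mem_minimalPrimes
    have h2 := ih reg.2
    rw [Module.supportDim_eq_of_equiv
      (Submodule.quotOfListConsSMulTopEquivQuotSMulTopInner M x rs), List.length_cons,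
      Nat.cast_add_one, ← add_assoc]
    exact (add_le_add_left h2 1).trans h1

open RingTheory.Sequence in
/-- Each element of a weakly regular sequence lowers the Krull dimension. -/
lemma ringKrullDim_quotient_ofList_add_length_le {R : Type*} [CommRing R] [IsNoetherianRing R]
    (rs : List R) (reg : IsWeaklyRegular R rs) :
    ringKrullDim (R ⧸ Ideal.ofList rs) + rs.length ≤ ringKrullDim R := by
  have eq : Ideal.ofList rs = Ideal.ofList rs • (⊤ : Ideal R) := by simp
  rw [ringKrullDim_eq_of_ringEquiv (Ideal.quotientEquivAlgOfEq R eq).toRingEquiv,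
    ← Module.supportDim_quotient_eq_ringKrullDim, ← Module.supportDim_self_eq_ringKrullDim]
  exact supportDim_add_length_le_of_isWeaklyRegular rs reg

lemma isPrime_otIdeal {ι : Type*} (f : ι → MvPolynomial (Fin ℓ) K) : (otIdeal f).IsPrime :=
  RingHom.ker_isPrime _

/-- Setting to zero the variables of the hyperplanes outside a flat maps Orlik–Terao relations
to Orlik–Terao relations. -/
lemma otIdeal_le_otIdeal_of_mem_iff {ι : Type*} {f g : ι → MvPolynomial (Fin ℓ) K}
    (hhom : ∀ i, (f i).IsHomogeneous 1) (v : Fin ℓ → K)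
    (h1 : ∀ i, aeval v (f i) = 0 → g i = f i) (h2 : ∀ i, aeval v (f i) ≠ 0 → g i = 0) :
    otIdeal f ≤ otIdeal g := by
  intro q hq
  have hx : ∀ p : MvPolynomial (Fin ℓ) K,
      aeval (fun m => algebraMap _ (RatFunField K ℓ) (X m : MvPolynomial (Fin ℓ) K)) p
        = algebraMap _ (RatFunField K ℓ) p := by
    intro p
    exact (aeval_algebraMap_apply (RatFunField K ℓ) X p).trans (by rw [aeval_X_left_apply])
  refine aeval_localization_eq_zero_of_mem_otIdeal (F := RatFunField K ℓ) hhom hq v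
    (fun m => algebraMap _ (RatFunField K ℓ) (X m : MvPolynomial (Fin ℓ) K)) ?_ ?_ ?_
  · intro i hi
    simpa [hx] using hi
  · intro i hi
    rw [hx, h1 i hi]
  · intro i hi
    simp [h2 i hi]

/-- The Orlik–Terao algebra has dimension at least the number of independent hyperplanes. -/
lemma natCast_le_ringKrullDim_quotient_otIdeal [Infinite K] {ι : Type*} [Finite ι]
    {f : ι → MvPolynomial (Fin ℓ) K} (hhom : ∀ i, (f i).IsHomogeneous 1) {r : ℕ}
    {b : Fin r → ι} (hb : LinearIndependent K (f ∘ b))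
    (hspan : ∀ i, f i ∈ Submodule.span K (Set.range (f ∘ b))) :
    (r : WithBot ℕ∞) ≤ ringKrullDim (MvPolynomial ι K ⧸ otIdeal f) := by
  classical
  let W : ℕ → Submodule K (MvPolynomial (Fin ℓ) K) := fun k =>
    Submodule.span K ((f ∘ b) '' {i | (i : ℕ) < k})
  have hW : Monotone W := fun k l hkl =>
    Submodule.span_mono (Set.image_mono fun i (hi : (i : ℕ) < k) => hi.trans_le hkl)
  have hWr : ∀ i, f i ∈ W r := fun i => by
    simpa [W, Function.comp_def] using hspan i
  have hmem : ∀ k : Fin r, f (b k) ∈ W (k + 1) := fun k =>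
    Submodule.subset_span ⟨k, by simp, rfl⟩
  have hnot : ∀ k : Fin r, f (b k) ∉ W k := fun k =>
    hb.notMem_span_image (s := {i : Fin r | (i : ℕ) < k}) (by simp)
  let g : ℕ → ι → MvPolynomial (Fin ℓ) K := fun k i => if f i ∈ W k then f i else 0
  have hg : ∀ k i, (g k i).IsHomogeneous 1 := by
    intro k i
    simp only [g]
    split_ifs
    exacts [hhom i, isHomogeneous_zero _ _ _]
  have hstep : ∀ k, otIdeal (g (k + 1)) ≤ otIdeal (g k) := by
    intro k
    obtain ⟨v, hv⟩ := exists_aeval_eq_zero_iff_mem (hg (k + 1)) (W k)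
    refine otIdeal_le_otIdeal_of_mem_iff (hg (k + 1)) v (fun i hi => ?_) (fun i hi => ?_)
    · rw [hv] at hi
      by_cases h : f i ∈ W k
      · simp [g, h, hW k.le_succ h]
      · have : f i ∉ W (k + 1) := fun h' => h (by simpa [g, h'] using hi)
        simp [g, h, this]
    · rw [Ne, hv] at hi
      have : f i ∉ W k := fun h => hi (by simpa [g, hW k.le_succ h] using h)
      simp [g, this]
  have hf0 : ∀ k : Fin r, f (b k) ≠ 0 := fun k => hb.ne_zero k
  have hlt : ∀ k : Fin r, otIdeal (g (k + 1)) < otIdeal (g k) := by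
    intro k
    refine lt_of_le_of_ne (hstep k) fun h => ?_
    have h1 : (X (b k) : MvPolynomial ι K) ∈ otIdeal (g k) := by
      change otMap (g k) (X (b k)) = 0
      simp [otMap, g, hnot k]
    rw [← h] at h1
    replace h1 : otMap (g (k + 1)) (X (b k)) = 0 := h1
    simp [otMap, g, hmem k] at h1
    exact hf0 k h1
  have hanti : Antitone fun k => otIdeal (g k) := antitone_nat_of_succ_le hstep
  have hgr : otIdeal (g r) = otIdeal f := by
    congr 1
    funext i
    simp [g, hWr i]
  rw [ringKrullDim_quotient]
  let s : LTSeries (PrimeSpectrum.zeroLocus (R := MvPolynomial ι K) (otIdeal f)) :=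
    { length := r
      toFun := fun k => ⟨⟨otIdeal (g (r - k)), isPrime_otIdeal _⟩, by
        rw [← hgr]
        exact hanti (Nat.sub_le _ _)⟩
      step := fun k => by
        have := hlt ⟨r - (k + 1), by have := k.2; omega⟩
        have e : r - (k + 1) + 1 = r - (k : ℕ) := by have := k.2; omega
        simp only [e] at this
        exact this }
  exact le_iSup (fun s : LTSeries (PrimeSpectrum.zeroLocus (R := MvPolynomial ι K)
    (otIdeal f)) => (s.length : WithBot ℕ∞)) s

end Dimension

section Jacobian

/-- By the Jacobian criterion at a generic point, the Orlik–Terao ideal needs at least as many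
generators as its codimension. -/
lemma card_le_length_add_of_otIdeal_eq_span [Infinite K] {ι : Type*} [Finite ι]
    {f : ι → MvPolynomial (Fin ℓ) K} (hhom : ∀ i, (f i).IsHomogeneous 1) (hne : ∀ i, f i ≠ 0)
    {r : ℕ} (b : Fin r → ι) (hspan : ∀ i, f i ∈ Submodule.span K (Set.range (f ∘ b)))
    {L : List (MvPolynomial ι K)} (hL : otIdeal f = Ideal.span {p | p ∈ L}) :
    Nat.card ι ≤ L.length + r := by
  classical
  have := Fintype.ofFinite ι
  obtain ⟨v, hv⟩ := exists_aeval_eq_zero_iff_mem hhom (⊥ : Submodule K (MvPolynomial (Fin ℓ) K))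
  have hv' : ∀ i, aeval v (f i) ≠ 0 := fun i h => hne i (by simpa using (hv i).1 h)
  let p : ι → K := fun i => (aeval v (f i))⁻¹
  have hp : ∀ q ∈ otIdeal f, aeval p q = 0 := fun q hq =>
    aeval_inv_eq_zero_of_mem_otIdeal hq (aeval v) fun i _ => hv' i
  let J := {j : ι // j ∉ Set.range b}
  let D : MvPolynomial ι K →ₗ[K] (J → K) := LinearMap.pi fun j =>
    (aeval p).toLinearMap ∘ₗ (pderiv j.1 : Derivation K _ _).toLinearMap
  have hD : ∀ q j, D q j = aeval p (pderiv j.1 q) := fun _ _ => rfl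
  have h1 : ∀ q ∈ otIdeal f, D q ∈ Submodule.span K (D '' {p | p ∈ L}) := by
    intro q hq
    rw [hL] at hq
    induction hq using Submodule.span_induction with
    | mem x hx => exact Submodule.subset_span ⟨x, hx, rfl⟩
    | zero => simp
    | add x y _ _ hx hy => rw [map_add]; exact add_mem hx hy
    | smul a x hx' hx =>
      have : D (a • x) = aeval p a • D x := by
        funext j
        have hx0 := hp x (by rw [hL]; exact hx')
        rw [hD, Pi.smul_apply, hD, smul_eq_mul, Derivation.leibniz, map_add, smul_eq_mul,
          smul_eq_mul, smul_eq_mul, map_mul, map_mul, hx0, zero_mul, add_zero]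
      rw [this]
      exact Submodule.smul_mem _ _ hx
  have h2 : ∀ j : J, ∃ q ∈ otIdeal f, ∃ c : K, c ≠ 0 ∧ D q = Pi.single j c := by
    intro j
    obtain ⟨α, hα⟩ := (Submodule.mem_span_range_iff_exists_fun K).1 (hspan j.1)
    let G : MvPolynomial ι K := ∏ i, X (b i)
    let H : MvPolynomial ι K := ∑ i, C (α i) * ∏ k ∈ Finset.univ.erase i, X (b k)
    have hG : ∀ k : J, pderiv k.1 G = 0 := by
      intro k
      apply pderiv_eq_zero_of_notMem_vars
      intro h
      obtain ⟨i, -, hi⟩ := Finset.mem_biUnion.1 (vars_prod _ h)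
      rw [vars_X, Finset.mem_singleton] at hi
      exact k.2 ⟨i, hi.symm⟩
    have hH : ∀ k : J, pderiv k.1 H = 0 := by
      intro k
      simp only [H, map_sum]
      refine Finset.sum_eq_zero fun m _ => ?_
      rw [pderiv_C_mul, pderiv_eq_zero_of_notMem_vars, mul_zero]
      intro h
      obtain ⟨i, -, hi⟩ := Finset.mem_biUnion.1 (vars_prod _ h)
      rw [vars_X, Finset.mem_singleton] at hi
      exact k.2 ⟨i, hi.symm⟩
    have key : ∀ {F : Type _} [Field F] [Algebra K F] (ψ : MvPolynomial (Fin ℓ) K →ₐ[K] F),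
        (∀ i, ψ (f i) ≠ 0) →
        aeval (fun i => (ψ (f i))⁻¹) H = ψ (f j) * ∏ i, (ψ (f (b i)))⁻¹ := by
      intro F _ _ ψ hψ
      simp only [H, ← hα, map_sum, map_mul, map_smul, map_prod, aeval_X, aeval_C, Finset.sum_mul]
      refine Finset.sum_congr rfl fun i _ => ?_
      rw [← Finset.mul_prod_erase Finset.univ _ (Finset.mem_univ i), Algebra.smul_def,
        Function.comp_apply, mul_assoc, mul_inv_cancel_left₀ (hψ _)]
    refine ⟨G - X j.1 * H, ?_, -(aeval p H), ?_, ?_⟩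
    · let ψ := IsScalarTower.toAlgHom K (MvPolynomial (Fin ℓ) K) (RatFunField K ℓ)
      have hψ : ∀ i, ψ (f i) ≠ 0 := fun i => by simpa [ψ] using hne i
      have e : otMap f = aeval (fun i => (ψ (f i))⁻¹) := rfl
      change otMap f _ = 0
      rw [e, map_sub, map_mul, key ψ hψ, aeval_X, inv_mul_cancel_left₀ (hψ _)]
      simp [G]
    · rw [key (aeval v) hv', neg_ne_zero]
      exact mul_ne_zero (hv' _) (Finset.prod_ne_zero_iff.2 fun i _ => inv_ne_zero (hv' _))
    · funext k
      rw [hD, map_sub, Derivation.leibniz, hG, hH, smul_zero, zero_add, zero_sub, pderiv_X,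
        smul_eq_mul, map_neg, map_mul]
      by_cases h : k = j
      · subst h; simp
      · have : j.1 ≠ k.1 := fun h' => h (Subtype.ext h'.symm)
        simp [h, this]
  have h3 : Submodule.span K (D '' {p | p ∈ L}) = ⊤ := by
    rw [eq_top_iff, ← (Pi.basisFun K J).span_eq, Submodule.span_le]
    rintro _ ⟨j, rfl⟩
    obtain ⟨q, hq, c, hc, h⟩ := h2 j
    have h4 := Submodule.smul_mem _ c⁻¹ (h1 q hq)
    rw [h, ← Pi.single_smul, smul_eq_mul, inv_mul_cancel₀ hc] at h4
    simpa using h4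
  have h5 : Nat.card J ≤ L.length := by
    have e : D '' {p | p ∈ L} = ((L.toFinset.image D : Finset (J → K)) : Set (J → K)) := by
      ext; simp
    have h6 := finrank_span_finset_le_card (R := K) (L.toFinset.image D)
    rw [← e, Set.finrank, h3, finrank_top, Module.finrank_fintype_fun_eq_card,
      ← Nat.card_eq_fintype_card] at h6
    exact h6.trans (Finset.card_image_le.trans L.toFinset_card_le)
  have h6 : Nat.card (Set.range b) ≤ r := by
    simpa using Finite.card_range_le b
  have h7 : Nat.card ι = Nat.card (Set.range b) + Nat.card J := by
    rw [← Nat.card_congr (Equiv.sumCompl fun i => i ∈ Set.range b), Nat.card_sum]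
  omega

end Jacobian

section Quadrics

variable {σ : Type*}

/-- In an ideal generated by quadrics, the degree-two components are linear combinations of the
generators, and there are no components of smaller degree. -/
lemma homogeneousComponent_mem_of_mem_span {S : Set (MvPolynomial σ K)}
    (hS : ∀ p ∈ S, p.IsHomogeneous 2) {p : MvPolynomial σ K} (hp : p ∈ Ideal.span S) :
    homogeneousComponent 2 p ∈ Submodule.span K S ∧
      ∀ m < 2, homogeneousComponent m p = 0 := by
  have key : ∀ (g : MvPolynomial σ K), ∀ s ∈ S, ∀ m, homogeneousComponent m (g * s)
      = ∑ i ∈ Finset.range (g.totalDegree + 1),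
        if m = i + 2 then homogeneousComponent i g * s else 0 := by
    intro g s hs m
    conv_lhs => rw [← sum_homogeneousComponent g, Finset.sum_mul, map_sum]
    refine Finset.sum_congr rfl fun i _ => homogeneousComponent_of_mem ?_
    exact (homogeneousComponent_isHomogeneous i g).mul (hS s hs)
  obtain ⟨c, hc, rfl⟩ := Submodule.mem_span_set.1 hp
  rw [Finsupp.sum]
  constructor
  · rw [map_sum]
    refine Submodule.sum_mem _ fun s hs => ?_
    rw [smul_eq_mul, key _ s (hc hs), Finset.sum_eq_single 0]
    · rw [if_pos rfl, homogeneousComponent_zero, ← smul_eq_C_mul]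
      exact Submodule.smul_mem _ _ (Submodule.subset_span (hc hs))
    · intro i _ hi
      rw [if_neg (by omega)]
    · simp
  · intro m hm
    rw [map_sum]
    refine Finset.sum_eq_zero fun s hs => ?_
    rw [smul_eq_mul, key _ s (hc hs)]
    exact Finset.sum_eq_zero fun i _ => if_neg (by omega)

lemma eq_zero_of_isHomogeneous_of_mem_span {S : Set (MvPolynomial σ K)}
    (hS : ∀ p ∈ S, p.IsHomogeneous 2) {p : MvPolynomial σ K} (hp : p ∈ Ideal.span S) {m : ℕ}
    (hm : m < 2) (hpm : p.IsHomogeneous m) : p = 0 := by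
  rw [← (homogeneousComponent_mem_of_mem_span hS hp).2 m hm, homogeneousComponent_of_mem hpm,
    if_pos rfl]

open RingTheory.Sequence in
/-- A weakly regular sequence of quadrics has no constant or linear syzygies. -/
lemma eq_zero_of_sum_mul_eq_zero_of_isWeaklyRegular {L : List (MvPolynomial σ K)}
    (hreg : IsWeaklyRegular (MvPolynomial σ K) L) (hL : ∀ p ∈ L, p.IsHomogeneous 2) {m : ℕ}
    (hm : m < 2) {g : Fin L.length → MvPolynomial σ K} (hg : ∀ t, (g t).IsHomogeneous m)
    (hsum : ∑ t, g t * L[t] = 0) (t : Fin L.length) : g t = 0 := by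
  have key : ∀ k ≤ L.length,
      ∑ t : Fin L.length, (if (t : ℕ) < k then g t * L[t] else 0) = 0 →
      ∀ t : Fin L.length, (t : ℕ) < k → g t = 0 := by
    intro k
    induction k with
    | zero => simp
    | succ k ih =>
      intro hk hs
      have hlast : g ⟨k, hk⟩ = 0 := by
        have hmem : ∀ s ∈ {p | p ∈ L.take k}, s.IsHomogeneous 2 :=
          fun s hs => hL s (List.mem_of_mem_take hs)
        refine eq_zero_of_isHomogeneous_of_mem_span hmem ?_ hm (hg _)
        have h1 := hreg.regular_mod_prev k hk
        have h2 : L[k] * g ⟨k, hk⟩ ∈ Ideal.ofList (L.take k) := by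
          have h3 : L[k] * g ⟨k, hk⟩
              = -∑ t : Fin L.length, (if (t : ℕ) < k then g t * L[t] else 0) := by
            rw [eq_neg_iff_add_eq_zero]
            refine Eq.trans ?_ hs
            rw [← Finset.sum_erase_add _ _ (Finset.mem_univ (⟨k, hk⟩ : Fin L.length)),
              ← Finset.sum_erase_add _ _ (Finset.mem_univ (⟨k, hk⟩ : Fin L.length))]
            simp only [lt_irrefl, if_false, add_zero, Nat.lt_succ_self, if_true]
            rw [add_comm, mul_comm]
            congr 1
            refine Finset.sum_congr rfl fun t ht => ?_
            have : (t : ℕ) ≠ k := fun h => (Finset.mem_erase.1 ht).1 (Fin.ext h)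
            simp [show (t : ℕ) < k + 1 ↔ (t : ℕ) < k by omega]
          rw [h3]
          refine neg_mem (sum_mem fun t _ => ?_)
          split_ifs with ht
          · refine Ideal.mul_mem_left _ _ (Ideal.subset_span ?_)
            exact List.mem_take_iff_getElem.2 ⟨t, by have := t.2; omega, rfl⟩
          · exact zero_mem _
        have h4 : Submodule.Quotient.mk (p := Ideal.ofList (L.take k) •
            (⊤ : Submodule (MvPolynomial σ K) (MvPolynomial σ K))) (g ⟨k, hk⟩) = 0 := by
          apply h1
          change L[k] • _ = L[k] • _
          rw [smul_zero, ← Submodule.Quotient.mk_smul, Submodule.Quotient.mk_eq_zero]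
          simpa using h2
        rw [Submodule.Quotient.mk_eq_zero] at h4
        simpa using h4
      have hrest := ih (by omega) (by
        refine Eq.trans ?_ hs
        refine Finset.sum_congr rfl fun t _ => ?_
        by_cases h : (t : ℕ) = k
        · have : t = ⟨k, hk⟩ := Fin.ext h
          subst this
          simp [hlast]
        · simp [show (t : ℕ) < k + 1 ↔ (t : ℕ) < k by omega])
      intro t ht
      by_cases h : (t : ℕ) = k
      · have : t = ⟨k, hk⟩ := Fin.ext h
        rwa [this]
      · exact hrest t (by omega)
  exact key _ le_rfl (by simpa using hsum) t t.2

/-- The quadrics of an ideal of a polynomial ring. -/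
noncomputable def quadricSubmodule (I : Ideal (MvPolynomial σ K)) :
    Submodule K (MvPolynomial σ K) :=
  I.restrictScalars K ⊓ homogeneousSubmodule σ K 2

lemma quadricSubmodule_eq_span {L : List (MvPolynomial σ K)} (hL : ∀ p ∈ L, p.IsHomogeneous 2) :
    quadricSubmodule (Ideal.span {p | p ∈ L}) =
      Submodule.span K (Set.range fun t : Fin L.length => L[t]) := by
  have e : (Set.range fun t : Fin L.length => L[t]) = {p | p ∈ L} := by
    ext p
    simp [List.mem_iff_get]
  rw [e]
  apply le_antisymm
  · rintro p ⟨hp, hp2⟩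
    have := (homogeneousComponent_mem_of_mem_span hL hp).1
    rwa [homogeneousComponent_of_mem hp2, if_pos rfl] at this
  · rw [Submodule.span_le]
    exact fun p hp => ⟨Ideal.subset_span hp, hL p hp⟩

open RingTheory.Sequence in
/-- A regular sequence of quadrics is a basis of the quadrics in the ideal it generates. -/
lemma finrank_quadricSubmodule {L : List (MvPolynomial σ K)} (hL : ∀ p ∈ L, p.IsHomogeneous 2)
    (hreg : IsWeaklyRegular (MvPolynomial σ K) L) :
    Module.finrank K (quadricSubmodule (Ideal.span {p | p ∈ L})) = L.length := by
  rw [quadricSubmodule_eq_span hL, finrank_span_eq_card, Fintype.card_fin]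
  rw [Fintype.linearIndependent_iff]
  intro c hc t
  have := eq_zero_of_sum_mul_eq_zero_of_isWeaklyRegular hreg hL (m := 0) (by norm_num)
    (g := fun t => C (c t)) (fun t => isHomogeneous_C _ _) (by simpa [smul_eq_C_mul] using hc) t
  simpa using this

end Quadrics

section QuadraticForms

variable {ι : Type*} [Fintype ι] {q : MvPolynomial ι K}

lemma exists_eq_sum_of_isHomogeneous_two (hq : q.IsHomogeneous 2) :
    ∃ a : ι → ι → K, q = ∑ i, ∑ j, C (a i j) * (X i * X j) := by
  rw [← mem_homogeneousSubmodule, ← homogeneousSubmodule_one_pow,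
    homogeneousSubmodule_one_eq_span_X, pow_two, Submodule.span_mul_span,
    ← Set.image2_mul, Set.image2_range, Submodule.mem_span_range_iff_exists_fun] at hq
  obtain ⟨a, rfl⟩ := hq
  refine ⟨fun i j => a (i, j), ?_⟩
  rw [Fintype.sum_prod_type]
  simp only [smul_eq_C_mul]

lemma coeff_sum_sum_C_mul_X_mul_X (a : ι → ι → K) {k l : ι} (hkl : k ≠ l) :
    coeff (Finsupp.single k 1 + Finsupp.single l 1) (∑ i, ∑ j, C (a i j) * (X i * X j))
      = a k l + a l k := by
  classical
  have key : ∀ i j, coeff (Finsupp.single k 1 + Finsupp.single l 1) (C (a i j) * (X i * X j))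
      = (if i = k then if j = l then a i j else 0 else 0)
        + (if i = l then if j = k then a i j else 0 else 0) := by
    intro i j
    rw [coeff_C_mul, X, X, monomial_mul, coeff_monomial]
    simp only [Finsupp.single_add_single_eq_single_add_single one_ne_zero one_ne_zero]
    by_cases h1 : i = k <;> by_cases h2 : j = l <;> by_cases h3 : i = l <;>
      by_cases h4 : j = k <;> simp_all
  simp only [coeff_sum, key, Finset.sum_add_distrib]
  simp

lemma coeff_single_add_single_self (a : ι → ι → K) (k : ι) :
    coeff (Finsupp.single k 1 + Finsupp.single k 1) (∑ i, ∑ j, C (a i j) * (X i * X j))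
      = a k k := by
  classical
  have key : ∀ i j, coeff (Finsupp.single k 1 + Finsupp.single k 1) (C (a i j) * (X i * X j))
      = if i = k then if j = k then a i j else 0 else 0 := by
    intro i j
    rw [coeff_C_mul, X, X, monomial_mul, coeff_monomial]
    simp only [Finsupp.single_add_single_eq_single_add_single one_ne_zero one_ne_zero]
    by_cases h1 : i = k <;> by_cases h2 : j = k <;> simp_all
  simp only [coeff_sum, key]
  simp

lemma eq_zero_of_isHomogeneous_two (hq : q.IsHomogeneous 2)
    (h : ∀ i j, coeff (Finsupp.single i 1 + Finsupp.single j 1) q = 0) : q = 0 := by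
  classical
  ext d
  rw [coeff_zero]
  by_contra hd
  obtain ⟨a, ha⟩ := exists_eq_sum_of_isHomogeneous_two hq
  have hd' := hd
  rw [ha, coeff_sum] at hd
  obtain ⟨i, -, hi⟩ := Finset.exists_ne_zero_of_sum_ne_zero hd
  rw [coeff_sum] at hi
  obtain ⟨j, -, hj⟩ := Finset.exists_ne_zero_of_sum_ne_zero hi
  rw [coeff_C_mul, X, X, monomial_mul, coeff_monomial] at hj
  split_ifs at hj with e
  · exact hd' (e ▸ h i j)
  · simp at hj

lemma aeval_eq_of_isHomogeneous_two {A : Type*} [CommRing A] [Algebra K A]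
    (hq : q.IsHomogeneous 2) {i : ι} {y : ι → A} (hy : ∀ k, k ≠ i → y k = 0) :
    aeval y q = algebraMap K A (coeff (Finsupp.single i 1 + Finsupp.single i 1) q) * y i ^ 2 := by
  classical
  obtain ⟨a, rfl⟩ := exists_eq_sum_of_isHomogeneous_two hq
  rw [coeff_single_add_single_self]
  simp only [map_sum, map_mul, aeval_X, aeval_C]
  rw [Finset.sum_eq_single i, Finset.sum_eq_single i, pow_two]
  · intro j _ hj; simp [hy j hj]
  · simp
  · intro j _ hj; simp [hy j hj]
  · simp

lemma aeval_eq_of_isHomogeneous_two_of_pair {A : Type*} [CommRing A] [Algebra K A]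
    (hq : q.IsHomogeneous 2)
    (hsq : ∀ i, coeff (Finsupp.single i 1 + Finsupp.single i 1) q = 0)
    {i j : ι} (hij : i ≠ j) {y : ι → A} (hy : ∀ l, l ≠ i → l ≠ j → y l = 0) :
    aeval y q =
      algebraMap K A (coeff (Finsupp.single i 1 + Finsupp.single j 1) q) * (y i * y j) := by
  classical
  obtain ⟨a, rfl⟩ := exists_eq_sum_of_isHomogeneous_two hq
  simp only [coeff_single_add_single_self] at hsq
  rw [coeff_sum_sum_C_mul_X_mul_X _ hij]
  simp only [map_sum, map_mul, aeval_X, aeval_C, map_add]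
  have key : ∀ g : ι → A, (∀ l, y l = 0 → g l = 0) → ∑ l, g l = g i + g j := by
    intro g hg
    rw [← Finset.sum_subset (Finset.subset_univ {i, j}), Finset.sum_pair hij]
    intro l _ hl
    simp only [Finset.mem_insert, Finset.mem_singleton, not_or] at hl
    exact hg l (hy l hl.1 hl.2)
  rw [key _ fun l hl => by simp [hl]]
  rw [key _ fun l hl => by simp [hl], key _ fun l hl => by simp [hl]]
  simp only [hsq, map_zero]
  ring

lemma aeval_eq_of_isHomogeneous_two_of_triple {A : Type*} [CommRing A] [Algebra K A]
    (hq : q.IsHomogeneous 2)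
    (hsq : ∀ i, coeff (Finsupp.single i 1 + Finsupp.single i 1) q = 0)
    {i j k : ι} (hij : i ≠ j) (hik : i ≠ k) (hjk : j ≠ k) {y : ι → A}
    (hy : ∀ l, l ≠ i → l ≠ j → l ≠ k → y l = 0) :
    aeval y q =
      algebraMap K A (coeff (Finsupp.single i 1 + Finsupp.single j 1) q) * (y i * y j) +
      algebraMap K A (coeff (Finsupp.single i 1 + Finsupp.single k 1) q) * (y i * y k) +
      algebraMap K A (coeff (Finsupp.single j 1 + Finsupp.single k 1) q) * (y j * y k) := by
  classical
  obtain ⟨a, rfl⟩ := exists_eq_sum_of_isHomogeneous_two hq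
  simp only [coeff_single_add_single_self] at hsq
  rw [coeff_sum_sum_C_mul_X_mul_X _ hij, coeff_sum_sum_C_mul_X_mul_X _ hik,
    coeff_sum_sum_C_mul_X_mul_X _ hjk]
  simp only [map_sum, map_mul, aeval_X, aeval_C, map_add]
  have key : ∀ g : ι → A, (∀ l, y l = 0 → g l = 0) → ∑ l, g l = g i + g j + g k := by
    intro g hg
    rw [← Finset.sum_subset (Finset.subset_univ {i, j, k})]
    · rw [Finset.sum_insert (by simp [hij, hik]), Finset.sum_pair hjk, add_assoc]
    · intro l _ hl
      simp only [Finset.mem_insert, Finset.mem_singleton, not_or] at hl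
      exact hg l (hy l hl.1 hl.2.1 hl.2.2)
  rw [key _ fun l hl => by simp [hl]]
  rw [key _ fun l hl => by simp [hl], key _ fun l hl => by simp [hl],
    key _ fun l hl => by simp [hl]]
  simp only [hsq, map_zero]
  ring

end QuadraticForms

section Circuits

/-- The quadric attached to a linear relation `α f_i + β f_j + γ f_k = 0`. -/
noncomputable def circuitQuadric {ι : Type*} (α β γ : K) (i j k : ι) : MvPolynomial ι K :=
  C α * (X j * X k) + C β * (X i * X k) + C γ * (X i * X j)

variable {ι : Type*}

lemma isHomogeneous_C_mul_X_mul_X (a : K) (i j : ι) :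
    (C a * (X i * X j) : MvPolynomial ι K).IsHomogeneous 2 := by
  simpa using (isHomogeneous_C ι a).mul ((isHomogeneous_X K i).mul (isHomogeneous_X K j))

lemma circuitQuadric_mem {f : ι → MvPolynomial (Fin ℓ) K} (hne : ∀ i, f i ≠ 0) {α β γ : K}
    {i j k : ι} (h : α • f i + β • f j + γ • f k = 0) :
    circuitQuadric α β γ i j k ∈ quadricSubmodule (otIdeal f) := by
  refine ⟨?_, ((isHomogeneous_C_mul_X_mul_X _ _ _).add (isHomogeneous_C_mul_X_mul_X _ _ _)).add
    (isHomogeneous_C_mul_X_mul_X _ _ _)⟩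
  change otMap f _ = 0
  have h' := congrArg (algebraMap (MvPolynomial (Fin ℓ) K) (RatFunField K ℓ)) h
  have hne' : ∀ i, algebraMap (MvPolynomial (Fin ℓ) K) (RatFunField K ℓ) (f i) ≠ 0 :=
    fun i => by simpa using hne i
  simp only [map_add, smul_eq_C_mul, map_mul, map_zero, ← algebraMap_eq,
    ← IsScalarTower.algebraMap_apply] at h'
  simp only [otMap, circuitQuadric, map_add, map_mul, aeval_X, aeval_C]
  have hi := hne' i
  have hj := hne' j
  have hk := hne' k
  field_simp
  linear_combination h'

lemma coeff_circuitQuadric (α β γ : K) {i j k : ι} (hik : i ≠ k) (hjk : j ≠ k) :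
    coeff (Finsupp.single i 1 + Finsupp.single j 1) (circuitQuadric α β γ i j k) = γ := by
  classical
  simp only [circuitQuadric, coeff_add, coeff_C_mul, X, monomial_mul, coeff_monomial,
    Finsupp.single_add_single_eq_single_add_single one_ne_zero one_ne_zero]
  simp [hik.symm, hjk.symm]

lemma mem_of_coeff_circuitQuadric_ne_zero {α β γ : K} {i j k a b : ι} {X : Finset ι}
    (hi : i ∈ X) (hj : j ∈ X) (hk : k ∈ X) (hab : a ≠ b)
    (h : coeff (Finsupp.single a 1 + Finsupp.single b 1) (circuitQuadric α β γ i j k) ≠ 0) :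
    a ∈ X ∧ b ∈ X := by
  classical
  have key : ∀ c : K, ∀ p q : ι, p ∈ X → q ∈ X →
      coeff (Finsupp.single a 1 + Finsupp.single b 1)
        (C c * (MvPolynomial.X p * MvPolynomial.X q)) ≠ 0 → a ∈ X ∧ b ∈ X := by
    intro c p q hp hq h
    rw [coeff_C_mul, MvPolynomial.X, MvPolynomial.X, monomial_mul, coeff_monomial] at h
    split_ifs at h with e
    · rcases (Finsupp.single_add_single_eq_single_add_single one_ne_zero one_ne_zero).1 e with
        ⟨rfl, rfl⟩ | ⟨-, rfl, rfl⟩ | ⟨-, -, e⟩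
      · exact ⟨hp, hq⟩
      · exact ⟨hq, hp⟩
      · exact absurd e hab
    · simp at h
  by_contra hX
  refine h ?_
  rw [circuitQuadric, coeff_add, coeff_add,
    not_not.1 fun h => hX (key _ _ _ hj hk h), not_not.1 fun h => hX (key _ _ _ hi hk h),
    not_not.1 fun h => hX (key _ _ _ hi hj h)]
  simp

open RingTheory.Sequence in
/-- Four concurrent lines of a rank-two flat produce a linear syzygy among three circuit quadrics,
which is impossible when these lie in the span of a regular sequence of quadrics. -/
lemma false_of_four_concurrent {f : ι → MvPolynomial (Fin ℓ) K} (hne : ∀ i, f i ≠ 0)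
    {L : List (MvPolynomial ι K)} (hreg : IsWeaklyRegular (MvPolynomial ι K) L)
    (hL : ∀ p ∈ L, p.IsHomogeneous 2) (hspan : otIdeal f = Ideal.span {p | p ∈ L})
    {i j k l : ι} (hjk : j ≠ k) (hjl : j ≠ l) (hil : i ≠ l) (hkl : k ≠ l)
    {α β γ δ : K} (hβ : β ≠ 0) (h1 : f k = α • f i + β • f j) (h2 : f l = γ • f i + δ • f j) :
    False := by
  classical
  have hr1 : circuitQuadric α β (-1) i j k ∈ quadricSubmodule (otIdeal f) :=
    circuitQuadric_mem hne (by rw [h1]; module)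
  have hr2 : circuitQuadric γ δ (-1) i j l ∈ quadricSubmodule (otIdeal f) :=
    circuitQuadric_mem hne (by rw [h2]; module)
  have hr3 : circuitQuadric (β * γ - δ * α) δ (-β) i k l ∈ quadricSubmodule (otIdeal f) :=
    circuitQuadric_mem hne (by rw [h1, h2]; module)
  rw [hspan, quadricSubmodule_eq_span hL, Submodule.mem_span_range_iff_exists_fun] at hr1 hr2 hr3
  obtain ⟨a, ha⟩ := hr1
  obtain ⟨b, hb⟩ := hr2
  obtain ⟨c, hc⟩ := hr3
  have hsyz : ∑ t, (C (c t) * X j - C (β * b t) * X k + C (δ * a t) * X l) * L[t]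
      = (0 : MvPolynomial ι K) := by
    have : ∑ t, (C (c t) * X j - C (β * b t) * X k + C (δ * a t) * X l) * L[t]
        = X j * (∑ t, c t • L[t]) - C β * X k * (∑ t, b t • L[t])
          + C δ * X l * ∑ t, a t • L[t] := by
      simp only [Finset.mul_sum, ← Finset.sum_sub_distrib, ← Finset.sum_add_distrib]
      refine Finset.sum_congr rfl fun t _ => ?_
      simp only [smul_eq_C_mul, C_mul]
      ring
    rw [this, ha, hb, hc]
    simp only [circuitQuadric, map_sub, map_neg, map_mul, map_one]
    ring
  have hc0 : ∀ t, c t = 0 := by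
    intro t
    have := eq_zero_of_sum_mul_eq_zero_of_isWeaklyRegular hreg hL (m := 1) (by norm_num)
      (fun t => by
        have e : ∀ (x : K) (i : ι), (C x * X i : MvPolynomial ι K).IsHomogeneous 1 :=
          fun x i => by simpa using (isHomogeneous_C ι x).mul (isHomogeneous_X K i)
        exact ((e _ _).sub (e _ _)).add (e _ _)) hsyz t
    simpa [hjk.symm, hjl.symm] using congrArg (eval (Pi.single j (1 : K))) this
  simp only [hc0, zero_smul, Finset.sum_const_zero] at hc
  have := congrArg (coeff (Finsupp.single i 1 + Finsupp.single k 1)) hc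
  rw [coeff_circuitQuadric _ _ _ hil hkl, coeff_zero, zero_eq_neg] at this
  exact hβ this

end Circuits

section Flats

variable {f : Fin n → MvPolynomial (Fin ℓ) K}

lemma linearIndependent_pair (hne : ∀ i, f i ≠ 0)
    (hdistinct : ∀ i j : Fin n, i ≠ j → ∀ a : K, f i ≠ a • f j) {i j : Fin n} (hij : i ≠ j) :
    LinearIndependent K ![f i, f j] :=
  (LinearIndependent.pair_iff' (hne i)).2 fun a h => hdistinct j i hij.symm a h.symm

lemma finrank_span_pair (hne : ∀ i, f i ≠ 0)
    (hdistinct : ∀ i j : Fin n, i ≠ j → ∀ a : K, f i ≠ a • f j) {i j : Fin n} (hij : i ≠ j) :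
    Module.finrank K (Submodule.span K {f i, f j}) = 2 := by
  have := finrank_span_eq_card (linearIndependent_pair hne hdistinct hij)
  rwa [Matrix.range_cons_cons_empty, Fintype.card_fin] at this

/-- A rank-two flat is determined by any two of its hyperplanes. -/
lemma IsRank2Flat.mem_iff (hne : ∀ i, f i ≠ 0)
    (hdistinct : ∀ i j : Fin n, i ≠ j → ∀ a : K, f i ≠ a • f j) {X : Finset (Fin n)}
    (hX : IsRank2Flat f X) {i j : Fin n} (hi : i ∈ X) (hj : j ∈ X) (hij : i ≠ j) (k : Fin n) :
    k ∈ X ↔ f k ∈ Submodule.span K {f i, f j} := by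
  have : FiniteDimensional K (Submodule.span K (f '' ↑X)) :=
    FiniteDimensional.span_of_finite K (X.finite_toSet.image f)
  have e : Submodule.span K {f i, f j} = Submodule.span K (f '' ↑X) := by
    refine Submodule.eq_of_le_of_finrank_eq (Submodule.span_mono ?_)
      (by rw [finrank_span_pair hne hdistinct hij, hX.1])
    rintro _ (rfl | rfl)
    · exact ⟨i, hi, rfl⟩
    · exact ⟨j, hj, rfl⟩
  rw [e]
  exact ⟨fun hk => Submodule.subset_span ⟨k, hk, rfl⟩, hX.2 k⟩

lemma IsRank2Flat.eq_of_mem (hne : ∀ i, f i ≠ 0)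
    (hdistinct : ∀ i j : Fin n, i ≠ j → ∀ a : K, f i ≠ a • f j) {X Y : Finset (Fin n)}
    (hX : IsRank2Flat f X) (hY : IsRank2Flat f Y) {i j : Fin n} (hij : i ≠ j)
    (hi : i ∈ X ∧ i ∈ Y) (hj : j ∈ X ∧ j ∈ Y) : X = Y := by
  ext k
  rw [hX.mem_iff hne hdistinct hi.1 hj.1 hij, hY.mem_iff hne hdistinct hi.2 hj.2 hij]

lemma exists_isRank2Flat (hne : ∀ i, f i ≠ 0)
    (hdistinct : ∀ i j : Fin n, i ≠ j → ∀ a : K, f i ≠ a • f j) {i j : Fin n} (hij : i ≠ j) :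
    ∃ X : Finset (Fin n), IsRank2Flat f X ∧ i ∈ X ∧ j ∈ X := by
  classical
  let X : Finset (Fin n) := Finset.univ.filter fun k => f k ∈ Submodule.span K {f i, f j}
  have hmem : ∀ k, k ∈ X ↔ f k ∈ Submodule.span K {f i, f j} := fun k => by simp [X]
  have hi : i ∈ X := (hmem i).2 (Submodule.subset_span (by simp))
  have hj : j ∈ X := (hmem j).2 (Submodule.subset_span (by simp))
  have e : Submodule.span K (f '' ↑X) = Submodule.span K {f i, f j} := by
    apply le_antisymm
    · rw [Submodule.span_le]
      rintro _ ⟨k, hk, rfl⟩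
      exact (hmem k).1 hk
    · refine Submodule.span_mono ?_
      rintro _ (rfl | rfl)
      · exact ⟨i, hi, rfl⟩
      · exact ⟨j, hj, rfl⟩
  refine ⟨X, ⟨?_, fun k hk => ?_⟩, hi, hj⟩
  · rw [e, finrank_span_pair hne hdistinct hij]
  · rwa [hmem, ← e]

open RingTheory.Sequence in
lemma IsRank2Flat.card_le_three (hne : ∀ i, f i ≠ 0)
    (hdistinct : ∀ i j : Fin n, i ≠ j → ∀ a : K, f i ≠ a • f j)
    {L : List (MvPolynomial (Fin n) K)} (hreg : IsWeaklyRegular (MvPolynomial (Fin n) K) L)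
    (hL : ∀ p ∈ L, p.IsHomogeneous 2) (hspan : otIdeal f = Ideal.span {p | p ∈ L})
    {X : Finset (Fin n)} (hX : IsRank2Flat f X) : X.card ≤ 3 := by
  by_contra! h
  obtain ⟨Y, hYX, hY⟩ := Finset.exists_subset_card_eq h
  obtain ⟨i, j, k, l, hij, hik, hil, hjk, hjl, hkl, rfl⟩ := Finset.card_eq_four.1 hY
  simp only [Finset.insert_subset_iff, Finset.singleton_subset_iff] at hYX
  obtain ⟨hi, hj, hk, hl⟩ := hYX
  obtain ⟨α, β, h1⟩ := Submodule.mem_span_pair.1 ((hX.mem_iff hne hdistinct hi hj hij k).1 hk)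
  obtain ⟨γ, δ, h2⟩ := Submodule.mem_span_pair.1 ((hX.mem_iff hne hdistinct hi hj hij l).1 hl)
  refine false_of_four_concurrent hne hreg hL hspan hjk hjl hil hkl ?_ h1.symm h2.symm
  rintro rfl
  exact hdistinct k i hik.symm α (by simpa using h1.symm)

/-- If all rank-two flats have at most three elements, the quadrics in the Orlik–Terao ideal
have one dimension for each triple point. -/
lemma finrank_quadricSubmodule_otIdeal [Infinite K] (hhom : ∀ i, (f i).IsHomogeneous 1)
    (hne : ∀ i, f i ≠ 0) (hdistinct : ∀ i j : Fin n, i ≠ j → ∀ a : K, f i ≠ a • f j)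
    (hcard : ∀ X : Finset (Fin n), IsRank2Flat f X → X.card ≤ 3) :
    Module.finrank K (quadricSubmodule (otIdeal f)) =
      {X : Finset (Fin n) | IsRank2Flat f X ∧ X.card = 3}.ncard := by
  classical
  let T := {X : Finset (Fin n) // IsRank2Flat f X ∧ X.card = 3}
  choose i j k hij hik hjk hT using fun X : T => Finset.card_eq_three.1 X.2.2
  have hi : ∀ X : T, i X ∈ X.1 := fun X => by rw [hT X]; simp
  have hj : ∀ X : T, j X ∈ X.1 := fun X => by rw [hT X]; simp
  have hk : ∀ X : T, k X ∈ X.1 := fun X => by rw [hT X]; simp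
  let Φ : quadricSubmodule (otIdeal f) →ₗ[K] (T → K) := LinearMap.pi fun X =>
    (lcoeff K (Finsupp.single (i X) 1 + Finsupp.single (j X) 1)).comp (Submodule.subtype _)
  have hΦ : ∀ q X, Φ q X = coeff (Finsupp.single (i X) 1 + Finsupp.single (j X) 1) q.1 :=
    fun _ _ => rfl
  have hsurj : Function.Surjective Φ := by
    have h1 : ∀ X : T, ∃ α β : K, α • f (i X) + β • f (j X) = f (k X) := fun X =>
      Submodule.mem_span_pair.1
        ((X.2.1.mem_iff hne hdistinct (hi X) (hj X) (hij X) (k X)).1 (hk X))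
    choose α β hαβ using h1
    let r : T → quadricSubmodule (otIdeal f) := fun X =>
      ⟨circuitQuadric (α X) (β X) (-1) (i X) (j X) (k X),
        circuitQuadric_mem hne (by rw [hαβ]; module)⟩
    have hr : ∀ X, Φ (r X) = Pi.single X (-1) := by
      intro X
      funext Y
      rw [hΦ]
      by_cases hXY : Y = X
      · subst hXY
        rw [Pi.single_eq_same]
        exact coeff_circuitQuadric _ _ _ (hik Y) (hjk Y)
      · rw [Pi.single_eq_of_ne hXY]
        by_contra h
        obtain ⟨h1, h2⟩ :=
          mem_of_coeff_circuitQuadric_ne_zero (hi X) (hj X) (hk X) (hij Y) h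
        exact hXY (Subtype.ext
          (Y.2.1.eq_of_mem hne hdistinct X.2.1 (hij Y) ⟨hi Y, h1⟩ ⟨hj Y, h2⟩))
    intro g
    refine ⟨∑ X, (-g X) • r X, ?_⟩
    simp only [map_sum, map_smul, hr]
    funext Y
    rw [Finset.sum_apply, Finset.sum_eq_single Y]
    · simp
    · intro X _ hX
      simp [hX.symm]
    · simp
  have hinj : Function.Injective Φ := by
    rw [injective_iff_map_eq_zero]
    rintro ⟨q, hqI, hq2⟩ h0
    have h0' : ∀ X, coeff (Finsupp.single (i X) 1 + Finsupp.single (j X) 1) q = 0 :=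
      fun X => congrFun h0 X
    let φ := algebraMap (MvPolynomial (Fin ℓ) K) (RatFunField K ℓ)
    have hφ : ∀ p, aeval (fun m => φ (X m)) p = φ p := by
      intro p
      have : aeval (fun m => φ (X m)) =
          IsScalarTower.toAlgHom K (MvPolynomial (Fin ℓ) K) (RatFunField K ℓ) := by
        ext m; simp [φ]
      rw [this]
      rfl
    have hφne : ∀ i, φ (f i) ≠ 0 := fun i => by simpa [φ] using hne i
    have hloc : ∀ W : Submodule K (MvPolynomial (Fin ℓ) K),
        aeval (fun i => if f i ∈ W then (φ (f i))⁻¹ else 0) q = 0 := by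
      intro W
      obtain ⟨v, hv⟩ := exists_aeval_eq_zero_iff_mem hhom W
      refine aeval_localization_eq_zero_of_mem_otIdeal hhom hqI v (fun m => φ (X m))
        (fun i _ => by rw [hφ]; exact hφne i) (fun i hi => ?_) (fun i hi => ?_)
      · rw [if_pos ((hv i).1 hi), hφ]
      · rw [if_neg fun h => hi ((hv i).2 h)]
    have hKinj : Function.Injective (algebraMap K (RatFunField K ℓ)) :=
      FaithfulSMul.algebraMap_injective _ _
    have hsq : ∀ i, coeff (Finsupp.single i 1 + Finsupp.single i 1) q = 0 := by
      intro i
      have h1 := hloc (Submodule.span K {f i})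
      rw [aeval_eq_of_isHomogeneous_two hq2 (i := i)] at h1
      · rw [if_pos (Submodule.mem_span_singleton_self _)] at h1
        simpa [hφne i] using h1
      · intro k hk
        rw [if_neg]
        intro h
        obtain ⟨a, ha⟩ := Submodule.mem_span_singleton.1 h
        exact hdistinct k i hk a ha.symm
    refine Subtype.ext (eq_zero_of_isHomogeneous_two hq2 fun a b => ?_)
    by_cases hab : a = b
    · rw [← hab, hsq]
    obtain ⟨X, hX, ha, hb⟩ := exists_isRank2Flat hne hdistinct hab
    have h1 := hloc (Submodule.span K {f a, f b})
    simp only [← hX.mem_iff hne hdistinct ha hb hab] at h1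
    by_cases hX3 : X.card = 3
    · let Y : T := ⟨X, hX, hX3⟩
      rw [aeval_eq_of_isHomogeneous_two_of_triple hq2 hsq (hij Y) (hik Y) (hjk Y), h0' Y,
        if_pos (hi Y), if_pos (hj Y), if_pos (hk Y), map_zero, zero_mul, zero_add] at h1
      · have h2 : coeff (Finsupp.single (i Y) 1 + Finsupp.single (k Y) 1) q • f (j Y)
            + coeff (Finsupp.single (j Y) 1 + Finsupp.single (k Y) 1) q • f (i Y) = 0 := by
          apply IsFractionRing.injective (MvPolynomial (Fin ℓ) K) (RatFunField K ℓ)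
          simp only [map_add, smul_eq_C_mul, map_mul, map_zero, ← algebraMap_eq,
            ← IsScalarTower.algebraMap_apply]
          have hi' := hφne (i Y)
          have hj' := hφne (j Y)
          have hk' := hφne (k Y)
          change _ * φ _ + _ * φ _ = 0
          field_simp at h1
          linear_combination h1
        obtain ⟨h3, h4⟩ := LinearIndependent.pair_iff.1
          (linearIndependent_pair hne hdistinct (hij Y).symm) _ _ h2
        have ha' : a ∈ ({i Y, j Y, k Y} : Finset (Fin n)) := hT Y ▸ ha
        have hb' : b ∈ ({i Y, j Y, k Y} : Finset (Fin n)) := hT Y ▸ hb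
        simp only [Finset.mem_insert, Finset.mem_singleton] at ha' hb'
        have h5 := h0' Y
        rcases ha' with rfl | rfl | rfl <;> rcases hb' with rfl | rfl | rfl <;>
          first
          | exact absurd rfl hab
          | assumption
          | (rw [add_comm]; assumption)
      · intro l hl1 hl2 hl3
        rw [if_neg]
        intro hl
        have : l ∈ ({i Y, j Y, k Y} : Finset (Fin n)) := hT Y ▸ hl
        simp [hl1, hl2, hl3] at this
    · rw [aeval_eq_of_isHomogeneous_two_of_pair hq2 hsq hab, if_pos ha, if_pos hb] at h1
      · simpa [hφne a, hφne b] using h1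
      · intro l hla hlb
        rw [if_neg]
        intro hl
        refine hX3 (le_antisymm (hcard X hX) ?_)
        rw [← Finset.card_eq_three.2 ⟨a, b, l, hab, hla.symm, hlb.symm, rfl⟩]
        refine Finset.card_le_card ?_
        simp [Finset.insert_subset_iff, ha, hb, hl]
  rw [(LinearEquiv.ofBijective Φ ⟨hinj, hsurj⟩).finrank_eq, Module.finrank_fintype_fun_eq_card,
    ← Nat.card_eq_fintype_card]
  rfl

end Flats

/-- if the Orlik–Terao ideal of a central essential arrangement
of `n` distinct hyperplanes of rank `ℓ` is a complete intersection generated by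
quadrics, then every rank-2 flat contains at most 3 hyperplanes, and the number
of rank-2 flats containing exactly 3 hyperplanes (triple points) is `n - ℓ`. -/
theorem stmt13 [IsAlgClosed K]
    (f : Fin n → MvPolynomial (Fin ℓ) K)
    (hhom : ∀ i, (f i).IsHomogeneous 1) (hne : ∀ i, f i ≠ 0)
    (hdistinct : ∀ i j : Fin n, i ≠ j → ∀ a : K, f i ≠ a • f j)
    (hessential : Module.finrank K (Submodule.span K (Set.range f)) = ℓ)
    (hqci : IsQuadCIdeal (otIdeal f)) :
    (∀ X : Finset (Fin n), IsRank2Flat f X → X.card ≤ 3) ∧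
    {X : Finset (Fin n) | IsRank2Flat f X ∧ X.card = 3}.ncard = n - ℓ := by
  obtain ⟨L, hreg, hL, hspan⟩ := hqci
  have := IsAlgClosed.instInfinite (K := K)
  have hflat : ∀ X : Finset (Fin n), IsRank2Flat f X → X.card ≤ 3 := fun X hX =>
    hX.card_le_three hne hdistinct hreg.toIsWeaklyRegular hL hspan
  refine ⟨hflat, ?_⟩
  rw [← finrank_quadricSubmodule_otIdeal hhom hne hdistinct hflat, hspan,
    finrank_quadricSubmodule hL hreg.toIsWeaklyRegular]
  obtain ⟨κ, b, hb, hbspan, hbind⟩ := exists_linearIndependent' K f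
  have : Finite κ := Finite.of_injective b hb
  have := Fintype.ofFinite κ
  have hκ : Fintype.card κ = ℓ := by
    rw [← hessential, ← hbspan, finrank_span_eq_card hbind]
  let e := (Fintype.equivFinOfCardEq hκ).symm
  have hrange : Set.range (f ∘ b ∘ e) = Set.range (f ∘ b) := by
    rw [← Function.comp_assoc, e.surjective.range_comp]
  have hbspan' : ∀ i, f i ∈ Submodule.span K (Set.range (f ∘ b ∘ e)) := fun i => by
    rw [hrange, hbspan]
    exact Submodule.subset_span ⟨i, rfl⟩
  have h1 : n ≤ L.length + ℓ := by
    simpa using card_le_length_add_of_otIdeal_eq_span hhom hne _ hbspan' hspan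
  have h2 : L.length + ℓ ≤ n := by
    have h3 := natCast_le_ringKrullDim_quotient_otIdeal hhom (hbind.comp e e.injective) hbspan'
    have h4 := ringKrullDim_quotient_ofList_add_length_le L hreg.toIsWeaklyRegular
    rw [MvPolynomial.ringKrullDim_of_isNoetherianRing, ringKrullDim_eq_zero_of_field, zero_add,
      Nat.card_fin, Ideal.ofList, ← hspan] at h4
    have h5 := (add_le_add_left h3 (L.length : WithBot ℕ∞)).trans h4
    have : ((ℓ + L.length : ℕ) : WithBot ℕ∞) ≤ (n : ℕ) := by exact_mod_cast h5
    have := Nat.cast_le.1 this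
    omega
  omega
end

section
/- Let A be a central essential arrangement of rank ℓ with n hyperplanes such that I(A) is a complete intersection generated by n - ℓ quadrics. Then the Poincaré polynomial of A satisfies π(A,t) = (1+t)^{2ℓ-n}(1+2t)^{n-ℓ}; in particular ℓ ≤ n ≤ 2ℓ - 1. -/
open MvPolynomial

variable {K : Type*} [Field K] {n ℓ : ℕ}

/-- Evaluating a polynomial at the inverses of elements `u i` becomes, after multiplication by a
power of `∏ u i`, the image of a single ring element, uniformly in the target field. -/
theorem exists_clear_inverses {R : Type*} [CommRing R] {σ : Type*} [Fintype σ]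
    (u : σ → R) (p : MvPolynomial σ R) :
    ∃ (N : ℕ) (P : R), ∀ (L : Type _) [Field L] (φ : R →+* L), (∀ i, φ (u i) ≠ 0) →
      φ P = (∏ i, φ (u i)) ^ N * eval₂ φ (fun i => (φ (u i))⁻¹) p := by
  classical
  induction p using MvPolynomial.induction_on with
  | C a => exact ⟨0, a, fun L _ φ _ => by simp⟩
  | add p q hp hq =>
    obtain ⟨N₁, P₁, h₁⟩ := hp
    obtain ⟨N₂, P₂, h₂⟩ := hq
    refine ⟨N₁ + N₂, (∏ i, u i) ^ N₂ * P₁ + (∏ i, u i) ^ N₁ * P₂, fun L _ φ h => ?_⟩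
    simp only [map_add, map_mul, map_pow, map_prod, h₁ L φ h, h₂ L φ h, eval₂_add]
    ring
  | mul_X p i hp =>
    obtain ⟨N, P, hP⟩ := hp
    refine ⟨N + 1, P * ∏ j ∈ Finset.univ.erase i, u j, fun L _ φ h => ?_⟩
    have := Finset.mul_prod_erase Finset.univ (fun j => φ (u j)) (Finset.mem_univ i)
    simp only [map_mul, map_prod, hP L φ h, eval₂_mul, eval₂_X]
    rw [pow_succ, ← this]
    field_simp [h i]

section Arrangement

variable {V : Type*} [AddCommGroup V] [Module K V]

/-- The polynomial `p` vanishes at `(1/f₁, …, 1/fₙ)` on the complement of the arrangement of the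
linear forms `fᵢ`. -/
def VanishesOnComplement (f : Fin n → Module.Dual K V) (p : MvPolynomial (Fin n) K) : Prop :=
  ∀ v, (∀ i, f i v ≠ 0) → eval (fun i => (f i v)⁻¹) p = 0

/-- The ideal generated by the relations `∑_{i ∈ S} aᵢ ∏_{j ∈ S, j ≠ i} yⱼ` coming from linear
dependencies `∑_{i ∈ S} aᵢ fᵢ = 0`. -/
noncomputable def dependencyIdeal {M : Type*} [AddCommGroup M] [Module K M] (f : Fin n → M) :
    Ideal (MvPolynomial (Fin n) K) :=
  Ideal.span {r | ∃ (S : Finset (Fin n)) (a : Fin n → K), ∑ i ∈ S, a i • f i = 0 ∧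
    r = ∑ i ∈ S, C (a i) * ∏ j ∈ S.erase i, X j}

theorem VanishesOnComplement.of_mem_dependencyIdeal {f : Fin n → Module.Dual K V}
    {p : MvPolynomial (Fin n) K} (hp : p ∈ dependencyIdeal f) : VanishesOnComplement f p := by
  intro v hv
  suffices dependencyIdeal f ≤ RingHom.ker (eval (fun i => (f i v)⁻¹)) from this hp
  refine Ideal.span_le.2 ?_
  rintro _ ⟨S, a, ha, rfl⟩
  have h0 := congrArg (fun g => g v) ha
  simp only [LinearMap.sum_apply, LinearMap.smul_apply, LinearMap.zero_apply, smul_eq_mul] at h0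
  simp only [SetLike.mem_coe, RingHom.mem_ker, map_sum, map_mul, map_prod, eval_C, eval_X]
  rw [← mul_zero (∏ j ∈ S, (f j v)⁻¹), ← h0, Finset.mul_sum]
  refine Finset.sum_congr rfl fun i hi => ?_
  rw [← Finset.mul_prod_erase S _ hi]
  field_simp [hv i]

theorem VanishesOnComplement.eval_leadingCoeff [Infinite K] {f : Fin (n + 1) → Module.Dual K V}
    {q : MvPolynomial (Fin (n + 1)) K} (hq : VanishesOnComplement f q) (hf : f 0 ≠ 0) {v : V}
    (hv0 : f 0 v = 0) (hv : ∀ i : Fin n, f i.succ v ≠ 0) :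
    eval (fun i : Fin n => (f i.succ v)⁻¹) (finSuccEquiv K n q).leadingCoeff = 0 := by
  obtain ⟨w, hw⟩ : ∃ w, f 0 w = 1 := by
    obtain ⟨w, hw⟩ := DFunLike.ne_iff.1 hf
    exact ⟨(f 0 w)⁻¹ • w, by simpa using inv_mul_cancel₀ hw⟩
  set P := finSuccEquiv K n q with hP
  set c : Fin n → Polynomial K := fun i =>
    Polynomial.C (f i.succ v) + Polynomial.X * Polynomial.C (f i.succ w) with hc
  have hceval : ∀ (s : K) i, Polynomial.evalRingHom s (c i) = f i.succ (v + s • w) := by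
    intro s i
    simp only [hc, Polynomial.coe_evalRingHom, Polynomial.eval_mul,
      Polynomial.eval_C, Polynomial.eval_X, map_add, map_smul, smul_eq_mul]
  set p : MvPolynomial (Fin n) (Polynomial K) :=
    ∑ k ∈ Finset.range (P.natDegree + 1),
      C (Polynomial.X ^ (P.natDegree - k)) * map Polynomial.C (P.coeff k) with hp
  have hpeval : ∀ (s : K) (y : Fin n → K), eval₂ (Polynomial.evalRingHom s) y p =
      ∑ k ∈ Finset.range (P.natDegree + 1), s ^ (P.natDegree - k) * eval y (P.coeff k) := by
    intro s y
    have : (Polynomial.evalRingHom s).comp Polynomial.C = RingHom.id K := by ext; simp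
    simp only [hp, eval₂_sum, eval₂_mul, eval₂_C, eval₂_map, this]
    refine Finset.sum_congr rfl fun k _ => ?_
    simp [eval₂_id]
  obtain ⟨N, Q, hQ⟩ := exists_clear_inverses c p
  have hcne : ∏ i, c i ≠ 0 := by
    refine Finset.prod_ne_zero_iff.2 fun i _ h => hv i ?_
    have := hceval 0 i
    rw [h] at this
    simpa using this.symm
  have hQ0 : Q = 0 := by
    have hz : Polynomial.X * (∏ i, c i) * Q = 0 := by
      refine Polynomial.funext fun s => ?_
      rw [Polynomial.eval_zero, Polynomial.eval_mul, Polynomial.eval_mul, Polynomial.eval_X]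
      by_cases hs : s = 0
      · simp [hs]
      by_cases hs' : ∀ i, Polynomial.evalRingHom s (c i) ≠ 0
      · have h1 := hQ K (Polynomial.evalRingHom s) hs'
        have h2 : eval₂ (Polynomial.evalRingHom s)
            (fun i => (Polynomial.evalRingHom s (c i))⁻¹) p = 0 := by
          rw [hpeval]
          have h3 := hq (v + s • w) (Fin.cases (by simp [hv0, hw, hs])
            fun i => by rw [← hceval]; exact hs' i)
          have h4 : (fun i => (f i (v + s • w))⁻¹) = Fin.cons s⁻¹
              (fun i => (Polynomial.evalRingHom s (c i))⁻¹) := by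
            funext i
            refine Fin.cases ?_ (fun i => ?_) i
            · simp [hv0, hw]
            · rw [Fin.cons_succ, hceval]
          rw [h4, eval_eq_eval_mv_eval', ← hP, Polynomial.eval_map,
            Polynomial.eval₂_eq_sum_range] at h3
          rw [← mul_zero (s ^ P.natDegree), ← h3, Finset.mul_sum]
          refine Finset.sum_congr rfl fun k hk => ?_
          have hk' : k ≤ P.natDegree := Nat.lt_succ_iff.1 (Finset.mem_range.1 hk)
          rw [pow_sub₀ _ hs hk', inv_pow]
          ring
        rw [h2, mul_zero, Polynomial.coe_evalRingHom] at h1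
        rw [h1, mul_zero]
      · push Not at hs'
        obtain ⟨i, hi⟩ := hs'
        rw [Polynomial.eval_prod, Finset.prod_eq_zero (Finset.mem_univ i) (by simpa using hi)]
        simp
    simpa [hcne, Polynomial.X_ne_zero] using hz
  have hv' : ∀ i, Polynomial.evalRingHom 0 (c i) = f i.succ v := fun i => by simp [hceval]
  have h0 := hQ K (Polynomial.evalRingHom 0) (fun i => by rw [hv']; exact hv i)
  rw [hQ0, map_zero, hpeval, Finset.sum_range_succ, Finset.sum_eq_zero, zero_add] at h0
  · simp only [hv', tsub_self, pow_zero, one_mul] at h0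
    exact (mul_eq_zero.1 h0.symm).resolve_left
      (pow_ne_zero _ (Finset.prod_ne_zero_iff.2 fun i _ => hv i))
  · intro k hk
    rw [zero_pow (by have := Finset.mem_range.1 hk; omega), zero_mul]

end Arrangement

section StandardMonomials

theorem monomial_cons_eq {R : Type*} [CommSemiring R] (k : ℕ) (m : Fin n →₀ ℕ) (r : R) :
    monomial (Finsupp.cons k m) r = X 0 ^ k * rename Fin.succ (monomial m r) := by
  have : Finsupp.cons k m = Finsupp.single 0 k + m.mapDomain Fin.succ := by
    ext i
    refine Fin.cases ?_ (fun i => ?_) i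
    · simp [Finsupp.mapDomain_of_notMem_range _ _
        (show (0 : Fin (n + 1)) ∉ Set.range Fin.succ by simp)]
    · simp [Finsupp.mapDomain_apply (Fin.succ_injective n)]
  rw [rename_monomial, X_pow_eq_monomial, monomial_mul, one_mul, this]

variable {M : Type*} [AddCommGroup M] [Module K M]

theorem rename_succ_mem_dependencyIdeal {f : Fin (n + 1) → M} {p : MvPolynomial (Fin n) K}
    (hp : p ∈ dependencyIdeal fun i : Fin n => f i.succ) :
    rename Fin.succ p ∈ dependencyIdeal f := by
  suffices dependencyIdeal (fun i : Fin n => f i.succ) ≤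
      (dependencyIdeal f).comap (rename Fin.succ : _ →ₐ[K] _) from this hp
  refine Ideal.span_le.2 ?_
  rintro _ ⟨S, a, ha, rfl⟩
  refine Ideal.subset_span ⟨S.map (Fin.succEmb n), Fin.cons 0 a, ?_, ?_⟩
  · simpa using ha
  · rw [Finset.sum_map, map_sum]
    refine Finset.sum_congr rfl fun i _ => ?_
    rw [← Finset.map_erase, Finset.prod_map]
    simp

variable {M' : Type*} [AddCommGroup M'] [Module K M']

theorem exists_X_mul_rename_sub_mem_dependencyIdeal {f : Fin (n + 1) → M} (ρ : M →ₗ[K] M')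
    (hρ : LinearMap.ker ρ ≤ Submodule.span K {f 0}) {p : MvPolynomial (Fin n) K}
    (hp : p ∈ dependencyIdeal fun i : Fin n => ρ (f i.succ)) :
    ∃ h : MvPolynomial (Fin n) K,
      X 0 * rename Fin.succ p - rename Fin.succ h ∈ dependencyIdeal f := by
  classical
  refine Submodule.span_induction ?_ ⟨0, by simp⟩ ?_ ?_ hp
  · rintro _ ⟨S, a, ha, rfl⟩
    have hker : ∑ i ∈ S, a i • f i.succ ∈ LinearMap.ker ρ := by
      simpa using ha
    obtain ⟨c, hc⟩ := Submodule.mem_span_singleton.1 (hρ hker)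
    refine ⟨C c * ∏ j ∈ S, X j, Ideal.subset_span
      ⟨insert 0 (S.map (Fin.succEmb n)), Fin.cons (-c) a, ?_, ?_⟩⟩
    · rw [Finset.sum_insert (by simp), Finset.sum_map]
      simp [← hc]
    · rw [Finset.sum_insert (by simp), Finset.sum_map, Finset.erase_insert (by simp),
        Finset.prod_map]
      have : ∀ i ∈ S, C ((Fin.cons (-c) a : Fin (n + 1) → K) (Fin.succEmb n i)) *
          ∏ j ∈ (insert 0 (S.map (Fin.succEmb n))).erase (Fin.succEmb n i), X j =
          (X 0 * (C (a i) * ∏ j ∈ S.erase i, X j.succ) : MvPolynomial (Fin (n + 1)) K) := by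
        intro i _
        rw [Finset.erase_insert_of_ne (by simp [(Fin.succ_ne_zero i).symm]),
          Finset.prod_insert (by simp), ← Finset.map_erase, Finset.prod_map]
        simp only [Fin.coe_succEmb, Fin.cons_succ]
        ring
      rw [Finset.sum_congr rfl this, ← Finset.mul_sum]
      simp only [map_sum, map_mul, map_prod, rename_C, rename_X, Fin.cons_zero, map_neg,
        Fin.coe_succEmb]
      ring
  · rintro x y _ _ ⟨h, hh⟩ ⟨h', hh'⟩
    refine ⟨h + h', ?_⟩
    convert add_mem hh hh' using 1
    simp only [map_add]
    ring
  · rintro g x _ ⟨h, hh⟩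
    refine ⟨g * h, ?_⟩
    convert Ideal.mul_mem_left _ (rename Fin.succ g) hh using 1
    simp only [smul_eq_mul, map_mul]
    ring

/-- Exponent vectors whose tail lies in `B₀` or in `B₁`, according to whether their zeroth entry
vanishes or not. -/
def consSet (B₀ B₁ : Set (Fin n →₀ ℕ)) : Set (Fin (n + 1) →₀ ℕ) :=
  {m | (m 0 = 0 ∧ m.tail ∈ B₀) ∨ (m 0 ≠ 0 ∧ m.tail ∈ B₁)}

theorem X_pow_mul_rename_mem_restrictSupport {R : Type*} [CommSemiring R] {B : Set (Fin n →₀ ℕ)}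
    {B' : Set (Fin (n + 1) →₀ ℕ)} {k : ℕ} (hB : ∀ m ∈ B, Finsupp.cons k m ∈ B')
    {b : MvPolynomial (Fin n) R} (hb : b ∈ restrictSupport R B) :
    X 0 ^ k * rename Fin.succ b ∈ restrictSupport R B' := by
  rw [restrictSupport_eq_span] at hb
  induction hb using Submodule.span_induction with
  | mem x hx =>
    obtain ⟨m, hm, rfl⟩ := hx
    simp only [← monomial_cons_eq]
    exact (monomial_mem_restrictSupport R).2 (Or.inl (hB m hm))
  | zero => simp
  | add x y _ _ hx hy => rw [map_add, mul_add]; exact add_mem hx hy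
  | smul a x _ hx =>
    rw [map_smul, mul_smul_comm]
    exact Submodule.smul_mem _ a hx

theorem dependencyIdeal_sup_restrictSupport_consSet {f : Fin (n + 1) → M} (ρ : M →ₗ[K] M')
    (hρ : LinearMap.ker ρ ≤ Submodule.span K {f 0}) {B₀ B₁ : Set (Fin n →₀ ℕ)}
    (h₀ : (dependencyIdeal fun i : Fin n => f i.succ).restrictScalars K ⊔
      restrictSupport K B₀ = ⊤)
    (h₁ : (dependencyIdeal fun i : Fin n => ρ (f i.succ)).restrictScalars K ⊔
      restrictSupport K B₁ = ⊤) :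
    (dependencyIdeal f).restrictScalars K ⊔ restrictSupport K (consSet B₀ B₁) = ⊤ := by
  have key : ∀ (k : ℕ) (g : MvPolynomial (Fin n) K), X 0 ^ k * rename Fin.succ g ∈
      (dependencyIdeal f).restrictScalars K ⊔ restrictSupport K (consSet B₀ B₁) := by
    intro k
    induction k with
    | zero =>
      intro g
      obtain ⟨j, hj, b, hb, rfl⟩ := Submodule.mem_sup.1 (h₀.ge (Submodule.mem_top (x := g)))
      rw [map_add, mul_add]
      refine Submodule.add_mem_sup ?_ (X_pow_mul_rename_mem_restrictSupport
        (fun m hm => Or.inl (by simpa using hm)) hb)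
      rw [pow_zero, one_mul]
      exact rename_succ_mem_dependencyIdeal hj
    | succ k ih =>
      intro g
      obtain ⟨j, hj, b, hb, rfl⟩ := Submodule.mem_sup.1 (h₁.ge (Submodule.mem_top (x := g)))
      rw [map_add, mul_add]
      refine add_mem ?_ (Submodule.mem_sup_right (X_pow_mul_rename_mem_restrictSupport
        (fun m hm => Or.inr (by simpa using hm)) hb))
      obtain ⟨h, hh⟩ := exists_X_mul_rename_sub_mem_dependencyIdeal ρ hρ hj
      have : (X 0 ^ (k + 1) * rename Fin.succ j : MvPolynomial (Fin (n + 1)) K) =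
          X 0 ^ k * (X 0 * rename Fin.succ j - rename Fin.succ h) +
            X 0 ^ k * rename Fin.succ h := by ring
      rw [this]
      exact add_mem (Submodule.mem_sup_left (Ideal.mul_mem_left _ _ hh)) (ih h)
  refine eq_top_iff.2 fun p _ => ?_
  induction p using MvPolynomial.induction_on' with
  | monomial m r =>
    rw [← Finsupp.cons_tail m, monomial_cons_eq]
    exact key _ _
  | add p q hp hq => exact add_mem (hp trivial) (hq trivial)

variable {V : Type*} [AddCommGroup V] [Module K V]

theorem VanishesOnComplement.eq_zero_of_mem_consSet [Infinite K]
    {f : Fin (n + 1) → Module.Dual K V} (hf : f 0 ≠ 0) {B₀ B₁ : Set (Fin n →₀ ℕ)}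
    (h₀ : ∀ q ∈ restrictSupport K B₀, VanishesOnComplement (fun i => f i.succ) q → q = 0)
    (h₁ : ∀ q ∈ restrictSupport K B₁,
      VanishesOnComplement (fun i => (f i.succ).domRestrict (LinearMap.ker (f 0))) q → q = 0)
    {q : MvPolynomial (Fin (n + 1)) K} (hqB : q ∈ restrictSupport K (consSet B₀ B₁))
    (hq : VanishesOnComplement f q) : q = 0 := by
  suffices (finSuccEquiv K n q).leadingCoeff = 0 by
    simpa using this
  have hsupp : ∀ m ∈ (finSuccEquiv K n q).leadingCoeff.support,
      Finsupp.cons (finSuccEquiv K n q).natDegree m ∈ consSet B₀ B₁ := fun m hm =>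
    hqB (mem_support_coeff_finSuccEquiv.1 hm)
  by_cases hd : (finSuccEquiv K n q).natDegree = 0
  · refine h₀ _ (fun m hm => ?_) fun v hv => ?_
    · simpa [consSet, hd] using hsupp m hm
    · by_cases hv0 : f 0 v = 0
      · exact hq.eval_leadingCoeff hf hv0 hv
      · have := hq v (Fin.cases hv0 hv)
        have h4 : (fun i => (f i v)⁻¹) = Fin.cons (f 0 v)⁻¹ (fun i : Fin n => (f i.succ v)⁻¹) := by
          funext i
          refine Fin.cases ?_ (fun i => ?_) i <;> simp
        rw [h4, eval_eq_eval_mv_eval', Polynomial.eq_C_of_natDegree_eq_zero hd,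
          Polynomial.map_C, Polynomial.eval_C] at this
        rwa [Polynomial.leadingCoeff, hd]
  · refine h₁ _ (fun m hm => ?_) fun v hv => ?_
    · simpa [consSet, hd] using hsupp m hm
    · exact hq.eval_leadingCoeff hf v.2 hv

end StandardMonomials

section Whitney

variable {M M' : Type*} [AddCommGroup M] [Module K M] [AddCommGroup M'] [Module K M']

variable (K) in
/-- The Poincaré polynomial of a family of vectors, through Whitney's subset expansion. -/
noncomputable def whitneyPoly (f : Fin n → M) : Polynomial ℚ :=
  ∑ S : Finset (Fin n),
    (-1 : Polynomial ℚ) ^ S.card *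
      (-(Polynomial.X : Polynomial ℚ)) ^ (Module.finrank K (Submodule.span K (f '' ↑S)))

theorem whitneyPoly_eq_one (f : Fin 0 → M) : whitneyPoly K f = 1 := by
  rw [whitneyPoly, Fintype.sum_eq_single ∅ (fun S hS => absurd (Subsingleton.elim S ∅) hS),
    Finset.coe_empty, Set.image_empty, Submodule.span_empty, finrank_bot K M]
  simp

theorem whitneyPoly_succ (f : Fin (n + 1) → M) :
    whitneyPoly K f = whitneyPoly K (fun i => f i.succ) -
      ∑ S : Finset (Fin n), (-1 : Polynomial ℚ) ^ S.card * (-(Polynomial.X : Polynomial ℚ)) ^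
        (Module.finrank K (Submodule.span K (insert (f 0) ((fun i : Fin n => f i.succ) '' (↑S : Set (Fin n)))))) := by
  classical
  unfold whitneyPoly
  have hu : (Finset.univ : Finset (Fin (n + 1))) =
      insert 0 (Finset.univ.map (Fin.succEmb n)) := by
    ext i; refine Fin.cases ?_ (fun i => ?_) i <;> simp
  have hpow : (Finset.univ.map (Fin.succEmb n)).powerset =
      Finset.univ.map (Finset.mapEmbedding (Fin.succEmb n)).toEmbedding := by
    ext S
    simp [Finset.subset_map_iff, eq_comm]
  have himg : ∀ S : Finset (Fin n), f '' (Fin.succ '' ↑S) =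
      (fun i : Fin n => f i.succ) '' ↑S :=
    fun S => Set.image_image _ _ _
  rw [← Finset.powerset_univ, hu, Finset.sum_powerset_insert (by simp), hpow,
    Finset.sum_map, Finset.sum_map, sub_eq_add_neg, ← Finset.sum_neg_distrib]
  congr 1
  · refine Finset.sum_congr rfl fun S _ => ?_
    rw [RelEmbedding.coe_toEmbedding, Finset.mapEmbedding_apply, Finset.card_map, Finset.coe_map,
      Fin.coe_succEmb, himg]
  · refine Finset.sum_congr rfl fun S _ => ?_
    rw [RelEmbedding.coe_toEmbedding, Finset.mapEmbedding_apply, Finset.card_insert_of_notMem (by simp), Finset.card_map,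
      Finset.coe_insert, Finset.coe_map, Set.image_insert_eq, Fin.coe_succEmb, himg, pow_succ]
    ring

theorem whitneyPoly_eq_zero_of_zero {f : Fin (n + 1) → M} (hf : f 0 = 0) :
    whitneyPoly K f = 0 := by
  rw [whitneyPoly_succ, hf, sub_eq_zero]
  refine Finset.sum_congr rfl fun S _ => ?_
  rw [Submodule.span_insert_zero]

theorem finrank_span_insert_of_ker_eq {v : M} (hv : v ≠ 0) (ρ : M →ₗ[K] M')
    (hρ : LinearMap.ker ρ = Submodule.span K {v}) {T : Set M} (hT : T.Finite) :
    Module.finrank K (Submodule.span K (insert v T)) =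
      Module.finrank K (Submodule.span K (ρ '' T)) + 1 := by
  have : FiniteDimensional K (Submodule.span K (insert v T)) :=
    FiniteDimensional.span_of_finite K (hT.insert v)
  have hv0 : ρ v = 0 := by
    rw [← LinearMap.mem_ker, hρ]; exact Submodule.mem_span_singleton_self v
  have h := LinearMap.finrank_range_add_finrank_ker (ρ.domRestrict (Submodule.span K (insert v T)))
  rw [LinearMap.range_domRestrict, LinearMap.ker_domRestrict, Submodule.map_span,
    Set.image_insert_eq, hv0, Submodule.span_insert_zero, hρ,
    ← Submodule.finrank_map_subtype_eq, Submodule.map_comap_subtype,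
    inf_eq_right.2 (Submodule.span_mono (by simp)), finrank_span_singleton hv] at h
  exact h.symm

theorem whitneyPoly_eq_add_X_mul {f : Fin (n + 1) → M} (hf : f 0 ≠ 0) (ρ : M →ₗ[K] M')
    (hρ : LinearMap.ker ρ = Submodule.span K {f 0}) :
    whitneyPoly K f = whitneyPoly K (fun i => f i.succ) +
      Polynomial.X * whitneyPoly K (fun i => ρ (f i.succ)) := by
  rw [whitneyPoly_succ, sub_eq_add_neg, ← Finset.sum_neg_distrib]
  congr 1
  rw [whitneyPoly, Finset.mul_sum]
  refine Finset.sum_congr rfl fun S _ => ?_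
  rw [finrank_span_insert_of_ker_eq hf ρ hρ (S.finite_toSet.image _), Set.image_image, pow_succ]
  ring

theorem eval_neg_one_whitneyPoly (hn : n ≠ 0) (f : Fin n → M) :
    (whitneyPoly K f).eval (-1) = 0 := by
  have := Finset.sum_powerset_neg_one_pow_card_of_nonempty
    (x := (Finset.univ : Finset (Fin n))) (Finset.card_pos.1 (by simpa using Nat.pos_of_ne_zero hn))
  rw [Finset.powerset_univ] at this
  simp [whitneyPoly, Polynomial.eval_finsetSum]
  exact_mod_cast this

end Whitney

section Count

/-- The generating function of a set of exponent vectors, counted by degree. -/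
noncomputable def countSeries (B : Set (Fin n →₀ ℕ)) : PowerSeries ℚ :=
  open Classical in
  PowerSeries.mk fun d => (((Finset.univ.finsuppAntidiag d).filter (· ∈ B)).card : ℚ)

/-- The power series `t / (1 - t)`. -/
def geomTail : PowerSeries ℚ := PowerSeries.mk fun i => if i = 0 then 0 else 1

theorem one_add_geomTail : 1 + geomTail = PowerSeries.mk 1 := by
  ext i
  rcases eq_or_ne i 0 with rfl | h
  · simp [geomTail]
  · simp [geomTail, PowerSeries.coeff_one, h]

theorem mem_finsuppAntidiag_univ {m : Fin n →₀ ℕ} {d : ℕ} :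
    m ∈ (Finset.univ : Finset (Fin n)).finsuppAntidiag d ↔ m.degree = d := by
  simp [Finset.mem_finsuppAntidiag, Finsupp.degree_eq_sum]

theorem countSeries_consSet (B₀ B₁ : Set (Fin n →₀ ℕ)) :
    countSeries (consSet B₀ B₁) = countSeries B₀ + geomTail * countSeries B₁ := by
  classical
  ext d
  have h1 : countSeries B₀ = (1 : PowerSeries ℚ) * countSeries B₀ := (one_mul _).symm
  rw [h1, map_add, PowerSeries.coeff_mul, PowerSeries.coeff_mul, ← Finset.sum_add_distrib]
  simp only [countSeries, geomTail, PowerSeries.coeff_mk, PowerSeries.coeff_one]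
  have : ∀ x ∈ Finset.HasAntidiagonal.antidiagonal d,
      ((if x.1 = 0 then 1 else 0) *
        (((Finset.univ.finsuppAntidiag x.2).filter (· ∈ B₀)).card : ℚ) +
      (if x.1 = 0 then 0 else 1) *
        (((Finset.univ.finsuppAntidiag x.2).filter (· ∈ B₁)).card : ℚ)) =
      (((Finset.univ.finsuppAntidiag x.2).filter
        (· ∈ if x.1 = 0 then B₀ else B₁)).card : ℚ) := by
    intro x _
    by_cases hx : x.1 = 0 <;> simp [hx]
  rw [Finset.sum_congr rfl this, ← Nat.cast_sum, ← Finset.card_sigma, Nat.cast_inj]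
  have hdeg : ∀ m : Fin (n + 1) →₀ ℕ, m.degree = m 0 + m.tail.degree := fun m => by
    simp [Finsupp.degree_eq_sum, Fin.sum_univ_succ, Finsupp.tail_apply]
  refine Finset.card_nbij' (fun m => ⟨(m 0, m.tail.degree), m.tail⟩)
    (fun x => Finsupp.cons x.1.1 x.2) ?_ ?_ ?_ ?_
  · intro m hm
    simp only [Finset.coe_filter, Set.mem_ofPred_eq, mem_finsuppAntidiag_univ, hdeg] at hm
    simp only [Finset.coe_sigma, Set.mem_sigma_iff, Finset.mem_coe, Finset.HasAntidiagonal.mem_antidiagonal,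
      Finset.mem_filter, mem_finsuppAntidiag_univ, true_and]
    refine ⟨hm.1, ?_⟩
    rcases hm.2 with ⟨h, h'⟩ | ⟨h, h'⟩ <;> simpa [h] using h'
  · rintro ⟨⟨i, j⟩, m⟩ hm
    simp only [Finset.coe_sigma, Set.mem_sigma_iff, Finset.mem_coe, Finset.HasAntidiagonal.mem_antidiagonal,
      Finset.mem_filter, mem_finsuppAntidiag_univ] at hm
    rw [Finset.mem_coe, Finset.mem_filter]
    simp only [Set.mem_ofPred_eq, mem_finsuppAntidiag_univ, hdeg, Finsupp.cons_zero, Finsupp.tail_cons, consSet, hm.2.1, hm.1, true_and]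
    by_cases hi : i = 0 <;> simpa [hi] using hm.2.2
  · intro m _
    exact Finsupp.cons_tail m
  · rintro ⟨⟨i, j⟩, m⟩ hm
    simp only [Finset.coe_sigma, Set.mem_sigma_iff, Finset.mem_coe, Finset.HasAntidiagonal.mem_antidiagonal,
      Finset.mem_filter, mem_finsuppAntidiag_univ] at hm
    simp [hm.2.1]

theorem countSeries_univ_zero : countSeries (Set.univ : Set (Fin 0 →₀ ℕ)) = 1 := by
  classical
  ext d
  rcases eq_or_ne d 0 with rfl | h
  · simp [countSeries]
  · simp [countSeries, PowerSeries.coeff_one, h]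

theorem countSeries_univ (n : ℕ) :
    countSeries (Set.univ : Set (Fin n →₀ ℕ)) = (1 + geomTail) ^ n := by
  induction n with
  | zero => rw [countSeries_univ_zero, pow_zero]
  | succ n ih =>
    have : (Set.univ : Set (Fin (n + 1) →₀ ℕ)) = consSet Set.univ Set.univ := by
      ext m; simp [consSet, em]
    rw [this, countSeries_consSet, ih]
    ring

end Count

section StandardMonomialsExist

theorem exists_standardMonomials [Infinite K] {n : ℕ} {V : Type*} [AddCommGroup V] [Module K V]
    (f : Fin n → Module.Dual K V) :
    ∃ B : Set (Fin n →₀ ℕ),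
      (dependencyIdeal f).restrictScalars K ⊔ restrictSupport K B = ⊤ ∧
      (∀ q ∈ restrictSupport K B, VanishesOnComplement f q → q = 0) ∧
      countSeries B = Polynomial.aeval geomTail (whitneyPoly K f) := by
  induction n generalizing V with
  | zero =>
    refine ⟨Set.univ, by simp, fun q _ hq => ?_, ?_⟩
    · have := hq 0 (fun i => i.elim0)
      rw [eq_C_of_isEmpty q, eval_C] at this
      rw [eq_C_of_isEmpty q, this, map_zero]
    · rw [countSeries_univ_zero, whitneyPoly_eq_one, map_one]
  | succ n ih =>
    by_cases hf : f 0 = 0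
    · refine ⟨∅, ?_, fun q hq _ => ?_, ?_⟩
      · have : dependencyIdeal (K := K) f = ⊤ := by
          refine (Ideal.eq_top_iff_one _).2 (Ideal.subset_span ⟨{0}, fun _ => 1, ?_, ?_⟩)
          · simp [hf]
          · simp
        rw [this]
        simp
      · simpa [mem_restrictSupport_iff] using hq
      · rw [whitneyPoly_eq_zero_of_zero hf, map_zero]
        ext d
        simp [countSeries]
    · set H := LinearMap.ker (f 0)
      have hker : LinearMap.ker H.dualRestrict = Submodule.span K {f 0} := by
        refine le_antisymm (fun g hg => ?_) ?_
        · have := mem_span_of_iInf_ker_le_ker (L := fun _ : Unit => f 0) (K := g) (by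
            rw [iInf_const]
            intro x hx
            exact congrArg (fun h => h ⟨x, hx⟩) (LinearMap.mem_ker.1 hg))
          simpa using this
        · rw [Submodule.span_singleton_le_iff_mem, LinearMap.mem_ker]
          ext x
          exact x.2
      obtain ⟨B₀, h₀, h₀', hc₀⟩ := ih fun i => f i.succ
      obtain ⟨B₁, h₁, h₁', hc₁⟩ := ih fun i => H.dualRestrict (f i.succ)
      refine ⟨consSet B₀ B₁, dependencyIdeal_sup_restrictSupport_consSet _ hker.le h₀ h₁,
        fun q hqB hq => hq.eq_zero_of_mem_consSet hf h₀' h₁' hqB, ?_⟩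
      rw [countSeries_consSet, hc₀, hc₁, whitneyPoly_eq_add_X_mul hf _ hker, map_add, map_mul,
        Polynomial.aeval_X]

end StandardMonomialsExist

section Hilbert

attribute [local instance] MvPolynomial.gradedAlgebra

variable {σ : Type*}

theorem homogeneousComponent_mem_of_isHomogeneous {I : Ideal (MvPolynomial σ K)}
    (hI : I.IsHomogeneous (homogeneousSubmodule σ K)) {p : MvPolynomial σ K} (hp : p ∈ I) (d : ℕ) :
    homogeneousComponent d p ∈ I := by
  rw [← decomposition.decompose'_apply]
  exact hI d hp

theorem homogeneousComponent_mul_of_le {p : MvPolynomial σ K} {k d : ℕ} (hp : p.IsHomogeneous k)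
    (h : k ≤ d) (q : MvPolynomial σ K) :
    homogeneousComponent d (p * q) = p * homogeneousComponent (d - k) q := by
  rw [← decomposition.decompose'_apply, ← decomposition.decompose'_apply]
  exact DirectSum.coe_decompose_mul_of_left_mem_of_le (homogeneousSubmodule σ K) hp h

theorem homogeneousComponent_mul_of_lt {p : MvPolynomial σ K} {k d : ℕ} (hp : p.IsHomogeneous k)
    (h : d < k) (q : MvPolynomial σ K) : homogeneousComponent d (p * q) = 0 := by
  rw [← decomposition.decompose'_apply]
  exact DirectSum.coe_decompose_mul_of_left_mem_of_not_le (homogeneousSubmodule σ K) hp h.not_ge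

theorem isHomogeneous_ofList {L : List (MvPolynomial σ K)} {k : ℕ}
    (hL : ∀ p ∈ L, p.IsHomogeneous k) :
    (Ideal.ofList L).IsHomogeneous (homogeneousSubmodule σ K) :=
  Ideal.homogeneous_span _ _ fun p hp => ⟨k, hL p hp⟩

/-- The degree `d` part of the quotient of a polynomial ring by the ideal `I`. -/
noncomputable def quotientPiece (I : Ideal (MvPolynomial σ K)) (d : ℕ) : Submodule K (MvPolynomial σ K ⧸ I) :=
  (homogeneousSubmodule σ K d).map (Ideal.Quotient.mkₐ K I).toLinearMap

/-- The Hilbert series of the quotient of a polynomial ring by the ideal `I`. -/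
noncomputable def hilbertSeries (I : Ideal (MvPolynomial σ K)) : PowerSeries ℚ :=
  PowerSeries.mk fun d => (Module.finrank K (quotientPiece I d) : ℚ)

instance [Finite σ] (I : Ideal (MvPolynomial σ K)) (d : ℕ) :
    FiniteDimensional K (quotientPiece I d) :=
  Module.Finite.iff_fg.2 ((homogeneousSubmodule_fg _ _ d).map _)

theorem hilbertSeries_eq_countSeries {I : Ideal (MvPolynomial (Fin n) K)}
    (hI : I.IsHomogeneous (homogeneousSubmodule (Fin n) K)) {B : Set (Fin n →₀ ℕ)}
    (hspan : I.restrictScalars K ⊔ restrictSupport K B = ⊤)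
    (hindep : ∀ q ∈ restrictSupport K B, q ∈ I → q = 0) :
    hilbertSeries I = countSeries B := by
  classical
  ext d
  simp only [hilbertSeries, countSeries, PowerSeries.coeff_mk, Nat.cast_inj]
  set s : Finset (Fin n →₀ ℕ) := (Finset.univ.finsuppAntidiag d).filter (· ∈ B) with hs
  have hsB : (s : Set (Fin n →₀ ℕ)) ⊆ B := fun m hm => (Finset.mem_filter.1 hm).2
  have hmap : quotientPiece I d =
      (restrictSupport K (s : Set (Fin n →₀ ℕ))).map (Ideal.Quotient.mkₐ K I).toLinearMap := by
    refine le_antisymm ?_ (Submodule.map_mono fun p hp m hm => ?_)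
    · rintro _ ⟨p, hp, rfl⟩
      obtain ⟨j, hj, b, hb, rfl⟩ := Submodule.mem_sup.1 (hspan.ge (Submodule.mem_top (x := p)))
      refine ⟨homogeneousComponent d b, fun m hm => ?_, ?_⟩
      · replace hm : m ∈ (homogeneousComponent d b).support := hm
        rw [support_homogeneousComponent, Finset.mem_filter] at hm
        rw [hs, Finset.mem_coe, Finset.mem_filter, mem_finsuppAntidiag_univ]
        exact ⟨hm.2, hb hm.1⟩
      · rw [← homogeneousComponent_eq_self hp, map_add, map_add]
        refine (add_eq_right.2 ?_).symm
        exact Ideal.Quotient.eq_zero_iff_mem.2 (homogeneousComponent_mem_of_isHomogeneous hI hj d)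
    · have := hp (Finset.mem_coe.2 (mem_support_iff.2 hm))
      rw [hs, Finset.mem_coe, Finset.mem_filter, mem_finsuppAntidiag_univ] at this
      rw [← this.1, Finsupp.degree_eq_weight_one]
      rfl
  rw [hmap, ← LinearMap.range_domRestrict, LinearMap.finrank_range_of_inj,
    Module.finrank_eq_card_basis (basisRestrictSupport K (s : Set (Fin n →₀ ℕ)))]
  · simp
  · rw [← LinearMap.ker_eq_bot, LinearMap.ker_eq_bot']
    intro q hq
    exact Subtype.ext (hindep q (restrictSupport_mono K hsB q.2)
      (Ideal.Quotient.eq_zero_iff_mem.1 hq))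

theorem hilbertSeries_sup_span_singleton [Finite σ] {I : Ideal (MvPolynomial σ K)}
    (hI : I.IsHomogeneous (homogeneousSubmodule σ K)) {p : MvPolynomial σ K} {k : ℕ}
    (hp : p.IsHomogeneous k) (hreg : ∀ x, p * x ∈ I → x ∈ I) :
    hilbertSeries (I ⊔ Ideal.span {p}) = (1 - PowerSeries.X ^ k) * hilbertSeries I := by
  set π : (MvPolynomial σ K ⧸ I) →ₐ[K] MvPolynomial σ K ⧸ (I ⊔ Ideal.span {p}) :=
    Ideal.Quotient.factorₐ K le_sup_left with hπ
  have hrank : ∀ d, Module.finrank K (quotientPiece (I ⊔ Ideal.span {p}) d) +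
      Module.finrank K ↥(quotientPiece I d ⊓ LinearMap.ker π.toLinearMap) =
      Module.finrank K (quotientPiece I d) := by
    intro d
    have h := LinearMap.finrank_range_add_finrank_ker (π.toLinearMap.domRestrict (quotientPiece I d))
    rw [LinearMap.range_domRestrict, LinearMap.ker_domRestrict,
      ← Submodule.finrank_map_subtype_eq, Submodule.map_comap_subtype, quotientPiece,
      ← Submodule.map_comp] at h
    exact h
  have hmem : ∀ d (r : MvPolynomial σ K), r.IsHomogeneous d → r ∈ I ⊔ Ideal.span {p} →
      ∃ s, r - homogeneousComponent d (p * s) ∈ I := by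
    intro d r hr hrI
    obtain ⟨i, hi, x, hx, rfl⟩ := Submodule.mem_sup.1 hrI
    obtain ⟨s, rfl⟩ := Ideal.mem_span_singleton'.1 hx
    refine ⟨s, ?_⟩
    rw [← homogeneousComponent_eq_self hr, map_add, mul_comm p s, add_sub_cancel_right]
    exact homogeneousComponent_mem_of_isHomogeneous hI hi d
  have hlt : ∀ d < k, Module.finrank K ↥(quotientPiece I d ⊓ LinearMap.ker π.toLinearMap) = 0 := by
    intro d hd
    rw [Submodule.finrank_eq_zero, eq_bot_iff]
    rintro _ ⟨⟨r, hr, rfl⟩, hker⟩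
    obtain ⟨s, hs⟩ := hmem d r hr (Ideal.Quotient.eq_zero_iff_mem.1 hker)
    rw [homogeneousComponent_mul_of_lt hp hd, sub_zero] at hs
    exact Ideal.Quotient.eq_zero_iff_mem.2 hs
  have hge : ∀ d, Module.finrank K
      ↥(quotientPiece I (d + k) ⊓ LinearMap.ker π.toLinearMap) =
      Module.finrank K (quotientPiece I d) := by
    intro d
    set μ := LinearMap.mulLeft K (Ideal.Quotient.mk I p) with hμ
    have hinj : Function.Injective μ := by
      rw [← LinearMap.ker_eq_bot, LinearMap.ker_eq_bot']
      intro x hx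
      obtain ⟨x, rfl⟩ := Ideal.Quotient.mk_surjective x
      rw [hμ, LinearMap.mulLeft_apply, ← map_mul, Ideal.Quotient.eq_zero_iff_mem] at hx
      exact Ideal.Quotient.eq_zero_iff_mem.2 (hreg x hx)
    have hmap : quotientPiece I (d + k) ⊓ LinearMap.ker π.toLinearMap =
        (quotientPiece I d).map μ := by
      refine le_antisymm ?_ ?_
      · rintro _ ⟨⟨r, hr, rfl⟩, hker⟩
        obtain ⟨s, hs⟩ := hmem (d + k) r hr (Ideal.Quotient.eq_zero_iff_mem.1 hker)
        rw [homogeneousComponent_mul_of_le hp (Nat.le_add_left k d), Nat.add_sub_cancel] at hs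
        refine ⟨_, ⟨homogeneousComponent d s, homogeneousComponent_isHomogeneous d s, rfl⟩, ?_⟩
        exact ((Ideal.Quotient.mk_eq_mk_iff_sub_mem _ _).2 hs).symm
      · rintro _ ⟨_, ⟨s, hs, rfl⟩, rfl⟩
        refine ⟨⟨p * s, add_comm k d ▸ hp.mul hs, rfl⟩, ?_⟩
        exact Ideal.Quotient.eq_zero_iff_mem.2 (Ideal.mem_sup_right
          (Ideal.mul_mem_right _ _ (Ideal.mem_span_singleton_self p)))
    rw [hmap, ← LinearMap.range_domRestrict, LinearMap.finrank_range_of_inj]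
    exact hinj.comp Subtype.val_injective
  ext d
  simp only [sub_mul, one_mul, map_sub, PowerSeries.coeff_X_pow_mul', hilbertSeries,
    PowerSeries.coeff_mk]
  rw [eq_sub_iff_add_eq]
  split_ifs with h
  · obtain ⟨e, rfl⟩ := Nat.exists_eq_add_of_le' h
    rw [Nat.add_sub_cancel, ← hrank (e + k), hge]
    push_cast
    ring
  · rw [← hrank, hlt d (not_le.1 h)]
    simp

end Hilbert

section Transfer

theorem aeval_geomTail_injective :
    Function.Injective (Polynomial.aeval (R := ℚ) geomTail) := by
  rw [injective_iff_map_eq_zero]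
  intro p hp
  by_contra h
  have hg : PowerSeries.constantCoeff geomTail = 0 := by
    simp [geomTail, ← PowerSeries.coeff_zero_eq_constantCoeff_apply]
  have hg' : geomTail ≠ 0 := fun h0 => by
    have := congrArg (PowerSeries.coeff 1) h0
    simp [geomTail] at this
  obtain ⟨q, hq, hq'⟩ := Polynomial.exists_eq_pow_rootMultiplicity_mul_and_not_dvd p h 0
  rw [map_zero, sub_zero, Polynomial.X_dvd_iff] at hq'
  rw [hq, map_zero, sub_zero, map_mul, map_pow, Polynomial.aeval_X] at hp
  have h0 := congrArg PowerSeries.constantCoeff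
    ((mul_eq_zero.1 hp).resolve_left (pow_ne_zero _ hg'))
  rw [Polynomial.aeval_def, Polynomial.hom_eval₂, hg, map_zero, Polynomial.eval₂_at_zero] at h0
  apply hq'
  simpa using h0

theorem one_sub_X_sq_mul_one_add_geomTail_sq :
    (1 - PowerSeries.X ^ 2) * (1 + geomTail) ^ 2 = 1 + 2 * geomTail := by
  have h : (1 + geomTail) * (1 - PowerSeries.X) = 1 := by
    rw [one_add_geomTail]
    exact PowerSeries.mk_one_mul_one_sub_eq_one ℚ
  linear_combination (1 + geomTail) * (1 + PowerSeries.X) * h - h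

theorem eq_of_mul_one_add_X_pow {W : Polynomial ℚ} {n c : ℕ} (hn : n ≠ 0) (hW : W.eval (-1) = 0)
    (h : W * (1 + Polynomial.X) ^ (2 * c) = (1 + 2 * Polynomial.X) ^ c * (1 + Polynomial.X) ^ n) :
    2 * c < n ∧ W = (1 + Polynomial.X) ^ (n - 2 * c) * (1 + 2 * Polynomial.X) ^ c := by
  have hX : (1 + Polynomial.X : Polynomial ℚ) ≠ 0 := fun h0 => by
    simpa using congrArg (Polynomial.eval 0) h0
  have hlt : 2 * c < n := by
    by_contra! hle
    obtain ⟨d, hd⟩ := Nat.exists_eq_add_of_le hle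
    rw [hd, pow_add, mul_left_comm, mul_comm] at h
    have := congrArg (Polynomial.eval (-1)) (mul_right_cancel₀ (pow_ne_zero n hX) h)
    rw [Polynomial.eval_mul, hW, zero_mul] at this
    norm_num at this
    exact pow_ne_zero c (by norm_num) this.symm
  refine ⟨hlt, mul_right_cancel₀ (pow_ne_zero (2 * c) hX) ?_⟩
  obtain ⟨d, rfl⟩ := Nat.exists_eq_add_of_le hlt.le
  rw [h, Nat.add_sub_cancel_left, pow_add]
  ring

theorem hilbertSeries_ofList {L : List (MvPolynomial (Fin n) K)} {k : ℕ}
    (hL : RingTheory.Sequence.IsWeaklyRegular (MvPolynomial (Fin n) K) L)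
    (hhom : ∀ p ∈ L, p.IsHomogeneous k) :
    hilbertSeries (Ideal.ofList L) = (1 - PowerSeries.X ^ k) ^ L.length * (1 + geomTail) ^ n := by
  suffices ∀ i ≤ L.length, hilbertSeries (Ideal.ofList (L.take i)) =
      (1 - PowerSeries.X ^ k) ^ i * (1 + geomTail) ^ n by
    simpa using this L.length le_rfl
  intro i
  induction i with
  | zero =>
    intro _
    rw [List.take_zero, pow_zero, one_mul, ← countSeries_univ]
    refine hilbertSeries_eq_countSeries (isHomogeneous_ofList (k := 0) (by simp)) ?_ ?_
    · rw [restrictSupport_univ, sup_top_eq]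
    · intro q _ hq
      simpa using hq
  | succ i ih =>
    intro hi
    have hreg := hL.regular_mod_prev i hi
    rw [List.take_succ_eq_append_getElem hi, Ideal.ofList_append, Ideal.ofList_singleton,
      hilbertSeries_sup_span_singleton
        (isHomogeneous_ofList fun p hp => hhom p (List.mem_of_mem_take hp))
        (hhom _ (List.getElem_mem hi)) ?_, ih (Nat.le_of_succ_le hi), pow_succ']
    · ring
    · intro x hx
      rw [smul_eq_mul, Ideal.mul_top] at hreg
      have := (isSMulRegular_iff_right_eq_zero_of_smul.1 hreg) (Ideal.Quotient.mk _ x)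
        (Ideal.Quotient.eq_zero_iff_mem.2 hx)
      exact Ideal.Quotient.eq_zero_iff_mem.1 this

end Transfer

section LinearForms

/-- The linear form on `K^ℓ` whose coefficients are the degree one coefficients of `p`. -/
noncomputable def linearFormOf (p : MvPolynomial (Fin ℓ) K) : Module.Dual K (Fin ℓ → K) :=
  ∑ j, coeff (Finsupp.single j 1) p • LinearMap.proj j

theorem eq_sum_coeff_single_of_isHomogeneous {p : MvPolynomial (Fin ℓ) K} (hp : p.IsHomogeneous 1) :
    p = ∑ j, C (coeff (Finsupp.single j 1) p) * X j := by
  ext m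
  rw [coeff_sum]
  simp_rw [coeff_C_mul, coeff_X]
  by_cases hm : m.degree = 1
  · obtain ⟨i, rfl⟩ : ∃ i, m = Finsupp.single i 1 := by
      obtain ⟨i, hi⟩ := Finsupp.ne_iff.1 (show m ≠ 0 by rintro rfl; simp at hm)
      have hle : Finsupp.single i 1 ≤ m := Finsupp.single_le_iff.2 (Nat.one_le_iff_ne_zero.2 hi)
      rw [← tsub_add_cancel_of_le hle, map_add, Finsupp.degree_single, Nat.add_eq_right,
        Finsupp.degree_eq_zero_iff] at hm
      exact ⟨i, by rw [← tsub_add_cancel_of_le hle, hm, zero_add]⟩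
    simp [Finsupp.single_left_inj]
  · rw [hp.coeff_eq_zero hm]
    refine (Finset.sum_eq_zero fun j _ => ?_).symm
    rw [if_neg, mul_zero]
    rintro rfl
    simp at hm

theorem eval_eq_linearFormOf {p : MvPolynomial (Fin ℓ) K} (hp : p.IsHomogeneous 1) (v : Fin ℓ → K) :
    eval v p = linearFormOf p v := by
  conv_lhs => rw [eq_sum_coeff_single_of_isHomogeneous hp]
  simp [linearFormOf]

theorem whitneyPoly_comp {M M' : Type*} [AddCommGroup M] [Module K M] [AddCommGroup M']
    [Module K M'] (g : M →ₗ[K] M') (hg : Function.Injective g) (f : Fin n → M) :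
    whitneyPoly K (g ∘ f) = whitneyPoly K f := by
  refine Finset.sum_congr rfl fun S _ => ?_
  rw [Set.image_comp, Submodule.span_image]
  congr 2
  exact (Submodule.equivMapOfInjective g hg _).finrank_eq.symm

theorem whitneyPoly_linearFormOf {f : Fin n → MvPolynomial (Fin ℓ) K}
    (hf : ∀ i, (f i).IsHomogeneous 1) :
    whitneyPoly K (fun i => linearFormOf (f i)) = whitneyPoly K f := by
  let g : Module.Dual K (Fin ℓ → K) →ₗ[K] MvPolynomial (Fin ℓ) K :=
    ∑ j, (LinearMap.applyₗ (Pi.single j 1)).smulRight (X j)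
  have hgφ : ∀ φ, g φ = ∑ j, φ (Pi.single j 1) • X j := fun φ => by
    simp [g, LinearMap.sum_apply]
  have hg : ∀ φ v, eval v (g φ) = φ v := fun φ v => by
    conv_rhs => rw [pi_eq_sum_univ' v, map_sum]
    simp [hgφ, smul_eval, mul_comm]
  have hgf : g ∘ (fun i => linearFormOf (f i)) = f := by
    ext1 i
    conv_rhs => rw [eq_sum_coeff_single_of_isHomogeneous (hf i)]
    simp [hgφ, linearFormOf, Pi.single_apply, C_mul']
  rw [← whitneyPoly_comp g (fun φ ψ h => LinearMap.ext fun v => by rw [← hg, h, hg]), hgf]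

theorem mem_otIdeal_iff [Infinite K] {f : Fin n → MvPolynomial (Fin ℓ) K}
    (hf : ∀ i, (f i).IsHomogeneous 1) (hne : ∀ i, f i ≠ 0) {p : MvPolynomial (Fin n) K} :
    p ∈ otIdeal f ↔ VanishesOnComplement (fun i => linearFormOf (f i)) p := by
  obtain ⟨N, P, hP⟩ := exists_clear_inverses f (map C p)
  have hinj := IsFractionRing.injective (MvPolynomial (Fin ℓ) K) (RatFunField K ℓ)
  have hne' : ∀ i, algebraMap _ (RatFunField K ℓ) (f i) ≠ 0 := fun i =>
    (map_ne_zero_iff _ hinj).2 (hne i)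
  have h₁ : p ∈ otIdeal f ↔ P = 0 := by
    have := hP (RatFunField K ℓ) (algebraMap _ _) hne'
    rw [← map_eq_zero_iff _ hinj, this, mul_eq_zero, or_iff_right
      (pow_ne_zero _ (Finset.prod_ne_zero_iff.2 fun i _ => hne' i)), eval₂_map]
    rfl
  have h₂ : ∀ v, (∀ i, linearFormOf (f i) v ≠ 0) →
      (eval v P = 0 ↔ eval (fun i => (linearFormOf (f i) v)⁻¹) p = 0) := by
    intro v hv
    simp only [← eval_eq_linearFormOf (hf _)] at hv ⊢
    rw [hP K (eval v) hv, mul_eq_zero, or_iff_right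
      (pow_ne_zero _ (Finset.prod_ne_zero_iff.2 fun i _ => hv i)), eval₂_map]
    have : (eval v).comp (C : K →+* MvPolynomial (Fin ℓ) K) = RingHom.id K := by
      ext; simp
    rw [this]
    rfl
  rw [h₁]
  refine ⟨fun h v hv => (h₂ v hv).1 (by rw [h, map_zero]), fun h => ?_⟩
  have : P * ∏ i, f i = 0 := MvPolynomial.funext fun v => by
    rw [map_mul, map_zero, map_prod]
    by_cases hv : ∀ i, linearFormOf (f i) v ≠ 0
    · rw [(h₂ v hv).2 (h v hv), zero_mul]
    · push Not at hv
      obtain ⟨i, hi⟩ := hv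
      rw [Finset.prod_eq_zero (Finset.mem_univ i) (by rw [eval_eq_linearFormOf (hf i), hi]),
        mul_zero]
  exact (mul_eq_zero.1 this).resolve_right (Finset.prod_ne_zero_iff.2 fun i _ => hne i)

attribute [local instance] MvPolynomial.gradedAlgebra in
theorem hilbertSeries_otIdeal [Infinite K] {f : Fin n → MvPolynomial (Fin ℓ) K}
    (hf : ∀ i, (f i).IsHomogeneous 1) (hne : ∀ i, f i ≠ 0)
    (hI : (otIdeal f).IsHomogeneous (homogeneousSubmodule (Fin n) K)) :
    hilbertSeries (otIdeal f) = Polynomial.aeval geomTail (whitneyPoly K f) := by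
  obtain ⟨B, hspan, hindep, hB⟩ := exists_standardMonomials fun i => linearFormOf (f i)
  rw [← whitneyPoly_linearFormOf hf, ← hB]
  refine hilbertSeries_eq_countSeries hI (top_le_iff.1 (hspan.ge.trans (sup_le_sup_right ?_ _)))
    fun q hqB hq => hindep q hqB ((mem_otIdeal_iff hf hne).1 hq)
  exact fun p hp => (mem_otIdeal_iff hf hne).2 (.of_mem_dependencyIdeal hp)

end LinearForms

open Polynomial in
/-- if the Orlik–Terao ideal of a central essential arrangement
of `n` hyperplanes of rank `ℓ` is a complete intersection generated by `n - ℓ`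
quadrics, then `π(A,t) = (1+t)^{2ℓ-n} (1+2t)^{n-ℓ}`; in particular
`ℓ ≤ n ≤ 2ℓ - 1`.  Here the Poincaré polynomial is given by Whitney's theorem:
`π(A,t) = Σ_{S ⊆ [n]} (-1)^{|S|} (-t)^{rk S}`. -/
theorem stmt14 [IsAlgClosed K]
    (f : Fin n → MvPolynomial (Fin ℓ) K)
    (hhom : ∀ i, (f i).IsHomogeneous 1) (hne : ∀ i, f i ≠ 0)
    (hdistinct : ∀ i j : Fin n, i ≠ j → ∀ a : K, f i ≠ a • f j)
    (hessential : Module.finrank K (Submodule.span K (Set.range f)) = ℓ)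
    (hqci : ∃ L : List (MvPolynomial (Fin n) K),
      RingTheory.Sequence.IsRegular (MvPolynomial (Fin n) K) L ∧
      (∀ p ∈ L, p.IsHomogeneous 2) ∧ L.length = n - ℓ ∧
      otIdeal f = Ideal.span {p | p ∈ L}) :
    (∑ S : Finset (Fin n),
        (-1 : Polynomial ℚ) ^ S.card *
          (-(Polynomial.X : Polynomial ℚ))
            ^ (Module.finrank K (Submodule.span K (f '' ↑S))))
      = (1 + Polynomial.X) ^ (2 * ℓ - n) * (1 + 2 * Polynomial.X) ^ (n - ℓ) ∧
    ℓ ≤ n ∧ n ≤ 2 * ℓ - 1 := by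
  obtain ⟨L, hL, hhom₂, hlen, hI⟩ := hqci
  change whitneyPoly K f = _ ∧ _
  have hle : ℓ ≤ n := by
    simpa [Set.finrank, hessential] using finrank_range_le_card (R := K) f
  rcases Nat.eq_zero_or_pos n with rfl | hn
  · obtain rfl : ℓ = 0 := by omega
    simp [whitneyPoly_eq_one]
  have hI' : otIdeal f = Ideal.ofList L := hI
  have hser := hilbertSeries_otIdeal hhom hne (hI' ▸ isHomogeneous_ofList hhom₂)
  rw [hI', hilbertSeries_ofList hL.toIsWeaklyRegular hhom₂, hlen] at hser
  obtain ⟨hlt, hW⟩ := eq_of_mul_one_add_X_pow (c := n - ℓ) hn.ne'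
    (eval_neg_one_whitneyPoly hn.ne' f) (aeval_geomTail_injective (by
      simp only [map_mul, map_pow, map_add, map_one, Polynomial.aeval_X, map_ofNat]
      rw [← hser, ← one_sub_X_sq_mul_one_add_geomTail_sq, mul_pow, ← pow_mul]
      ring))
  refine ⟨?_, hle, by omega⟩
  rw [hW, show n - 2 * (n - ℓ) = 2 * ℓ - n by omega]
end

section
/- Let A be a central essential arrangement such that the Orlik-Terao ideal I(A) is a complete intersection. Then for every flat X of A, the Orlik-Terao ideal I(A_X) of the closed subarrangement A_X is also a complete intersection; moreover if I(A) is generated by quadrics then so is I(A_X). -/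
open MvPolynomial

variable {K : Type*} [Field K] {n ℓ : ℕ}

open RingTheory.Sequence in
lemma isWeaklyRegular_of_map {A B : Type*} [CommRing A] [CommRing B] (φ : A →+* B) {l : List A}
    (h : IsWeaklyRegular B (l.map φ))
    (hφ : ∀ l', l' <+: l → ∀ a, φ a ∈ Ideal.ofList (l'.map φ) → a ∈ Ideal.ofList l') :
    IsWeaklyRegular A l := by
  refine ⟨fun i hi => ?_⟩
  have hreg := h.regular_mod_prev i (by simpa using hi)
  rw [isSMulRegular_quotient_iff_mem_of_smul_mem] at hreg ⊢
  simp only [smul_eq_mul, Ideal.mul_top, List.getElem_map, ← List.map_take] at hreg ⊢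
  intro x hx
  refine hφ _ (List.take_prefix i l) x (hreg _ ?_)
  have := Ideal.mem_map_of_mem φ hx
  rwa [Ideal.map_ofList, map_mul] at this

lemma Ideal.ofList_perm {R : Type*} [CommRing R] {l l' : List R} (h : l.Perm l') :
    Ideal.ofList l = Ideal.ofList l' := by
  unfold Ideal.ofList
  simp only [h.mem_iff]

lemma IsLocalRing.mem_sup_or_exists_perm {R : Type*} [CommRing R] [IsLocalRing R] {I : Ideal R}
    (T : Ideal R) (l : List R) (hl : ∀ y ∈ l, y ∈ I) (x : R) (hx : x ∈ Ideal.ofList l ⊔ T) :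
    x ∈ maximalIdeal R * I ⊔ T ∨
      ∃ y l' c, l.Perm (y :: l') ∧ IsUnit c ∧ x - c * y ∈ Ideal.ofList l' ⊔ T := by
  induction l generalizing x with
  | nil => exact .inl (Ideal.mem_sup_right (by simpa using hx))
  | cons y l ih =>
    rw [Ideal.ofList_cons, sup_assoc] at hx
    obtain ⟨w, hw, z, hz, rfl⟩ := Submodule.mem_sup.1 hx
    obtain ⟨c, rfl⟩ := Ideal.mem_span_singleton'.1 hw
    by_cases hc : IsUnit c
    · exact .inr ⟨y, l, c, .refl _, hc, by simpa using hz⟩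
    · rcases ih (fun v hv => hl v (by simp [hv])) z hz with h | ⟨y', l', c', hp, hc', h⟩
      · exact .inl (add_mem (Ideal.mem_sup_left
          (Ideal.mul_mem_mul ((mem_maximalIdeal c).2 hc) (hl y (by simp)))) h)
      · refine .inr ⟨y', y :: l', c', (hp.cons y).trans (.swap _ _ _), hc', ?_⟩
        rw [Ideal.ofList_cons, sup_assoc, add_sub_assoc]
        exact add_mem (Ideal.mem_sup_left hw) (Ideal.mem_sup_right h)

open RingTheory.Sequence in
/-- Exchange lemma: in a Noetherian local ring, elements of an ideal `I` generated by a regular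
sequence which are linearly independent modulo `𝔪 I` extend to a regular sequence generating
`I`. -/
lemma IsLocalRing.exists_isRegular_append {R : Type*} [CommRing R] [IsLocalRing R]
    [IsNoetherianRing R] {a : List R} (ha : IsRegular R a) (b : List R)
    (hb : ∀ x ∈ b, x ∈ Ideal.ofList a)
    (hind : ∀ x t, (x :: t) <:+ b → x ∉ maximalIdeal R * Ideal.ofList a ⊔ Ideal.ofList t) :
    ∃ a', IsRegular R (b ++ a') ∧ Ideal.ofList (b ++ a') = Ideal.ofList a := by
  induction b with
  | nil => exact ⟨a, ha, rfl⟩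
  | cons x t ih =>
    obtain ⟨a', hreg, hspan⟩ := ih (fun v hv => hb v (by simp [hv]))
      (fun v s hs => hind v s (hs.trans (List.suffix_cons x t)))
    have hx : x ∈ Ideal.ofList a' ⊔ Ideal.ofList t := by
      rw [sup_comm, ← Ideal.ofList_append, hspan]
      exact hb x (by simp)
    obtain ⟨y, l', c, hp, hc, hxy⟩ := (mem_sup_or_exists_perm (I := Ideal.ofList a) _ a'
      (fun y hy => hspan ▸ Ideal.subset_span (by simp [hy])) x hx).resolve_left
        (hind x t (List.suffix_refl _))
    set N := Ideal.ofList (t ++ l') with hN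
    have hxy' : x - c * y ∈ N := by rwa [hN, Ideal.ofList_append, sup_comm]
    have hp' : (t ++ a').Perm ((t ++ l') ++ [y]) :=
      (hp.append_left t).trans (by
        rw [List.append_assoc]
        exact (List.perm_append_singleton y l').symm.append_left t)
    have hI : Ideal.ofList ((t ++ l') ++ [x]) = Ideal.ofList a := by
      rw [← hspan, Ideal.ofList_perm hp', Ideal.ofList_append, Ideal.ofList_append _ [y],
        Ideal.ofList_singleton, Ideal.ofList_singleton]
      obtain ⟨d, hd⟩ := hc.exists_left_inv
      apply le_antisymm <;> refine sup_le le_sup_left ?_ <;>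
        rw [Ideal.span_singleton_le_iff_mem]
      · have : x = (x - c * y) + c * y := by ring
        rw [this]
        exact add_mem (Ideal.mem_sup_left hxy')
          (Ideal.mem_sup_right (Ideal.mul_mem_left _ _ (Ideal.mem_span_singleton_self y)))
      · have : y = -d * (x - c * y) + d * x := by linear_combination (-y) * hd
        rw [this]
        exact add_mem (Ideal.mem_sup_left (Ideal.mul_mem_left _ _ hxy'))
          (Ideal.mem_sup_right (Ideal.mul_mem_left _ _ (Ideal.mem_span_singleton_self x)))
    have hreg' := (isRegular_of_perm hreg hp').toIsWeaklyRegular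
    rw [isWeaklyRegular_append_iff, isWeaklyRegular_singleton_iff,
      isSMulRegular_quotient_iff_mem_of_smul_mem] at hreg'
    have hregx : IsRegular R ((t ++ l') ++ [x]) := by
      refine ⟨?_, ?_⟩
      · rw [isWeaklyRegular_append_iff, isWeaklyRegular_singleton_iff,
          isSMulRegular_quotient_iff_mem_of_smul_mem]
        refine ⟨hreg'.1, fun z hz => hreg'.2 z ?_⟩
        simp only [smul_eq_mul, Ideal.mul_top] at hz ⊢
        refine (Ideal.unit_mul_mem_iff_mem _ hc).1 ?_
        have : c * (y * z) = x * z - z * (x - c * y) := by ring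
        rw [this]
        exact sub_mem hz (Ideal.mul_mem_left _ _ hxy')
      · rw [hI]
        exact ha.top_ne_smul
    have hpx : ((t ++ l') ++ [x]).Perm (x :: t ++ l') := List.perm_append_singleton x (t ++ l')
    exact ⟨l', isRegular_of_perm hregx hpx, by rw [← Ideal.ofList_perm hpx, hI]⟩

/-- Every list contains a sublist which spans the same ideal modulo `J` and is irredundant
modulo `J`. -/
lemma exists_sublist_irredundant {R : Type*} [CommRing R] (J : Ideal R) (l : List R) :
    ∃ b, b.Sublist l ∧ Ideal.ofList l ≤ J ⊔ Ideal.ofList b ∧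
      ∀ x t, (x :: t) <:+ b → x ∉ J ⊔ Ideal.ofList t := by
  induction l with
  | nil => exact ⟨[], .refl _, by simp, by simp⟩
  | cons y l ih =>
    obtain ⟨b, hsub, hle, hirr⟩ := ih
    by_cases hy : y ∈ J ⊔ Ideal.ofList b
    · refine ⟨b, hsub.cons y, ?_, hirr⟩
      rw [Ideal.ofList_cons]
      exact sup_le ((Ideal.span_singleton_le_iff_mem _).2 hy) hle
    · refine ⟨y :: b, hsub.cons_cons y, ?_, fun x t hxt => ?_⟩
      · rw [Ideal.ofList_cons, Ideal.ofList_cons]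
        exact sup_le (le_sup_of_le_right le_sup_left)
          (hle.trans (sup_le_sup_left le_sup_right _))
      · rcases List.suffix_cons_iff.1 hxt with h | h
        · obtain ⟨rfl, rfl⟩ := List.cons.inj h
          exact hy
        · exact hirr x t h

namespace MvPolynomial

variable {σ : Type*}

attribute [local instance] MvPolynomial.gradedAlgebra

/-- A homogeneous ideal is contracted from the localization at the irrelevant ideal. -/
lemma mem_of_mul_mem_of_isHomogeneous {J : Ideal (MvPolynomial σ K)}
    (hJ : J.IsHomogeneous (homogeneousSubmodule σ K)) {u a : MvPolynomial σ K}
    (hu : constantCoeff u ≠ 0) (h : u * a ∈ J) : a ∈ J := by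
  have key : ∀ k : ℕ, ∃ w, a - w ∈ J ∧ ∀ d : σ →₀ ℕ, d.degree < k → coeff d w = 0 := by
    intro k
    induction k with
    | zero => exact ⟨a, by simp, by simp⟩
    | succ k ih =>
      obtain ⟨w, hw, hdeg⟩ := ih
      set c := constantCoeff u with hc
      have hcc : (C c⁻¹ * C c : MvPolynomial σ K) = 1 := by
        rw [← C_mul, inv_mul_cancel₀ hu, C_1]
      refine ⟨C (-c⁻¹) * ((u - C c) * w), ?_, fun d hd => ?_⟩
      · have : a - C (-c⁻¹) * ((u - C c) * w)
            = C c⁻¹ * (u * a) - (C c⁻¹ * (u - C c)) * (a - w) := by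
          rw [C_neg]
          linear_combination (-a) * hcc
        rw [this]
        exact sub_mem (J.mul_mem_left _ h) (J.mul_mem_left _ hw)
      · classical
        rw [coeff_C_mul, coeff_mul, Finset.sum_eq_zero, mul_zero]
        rintro ⟨x, y⟩ hxy
        rw [Finset.HasAntidiagonal.mem_antidiagonal] at hxy
        by_cases hy : y.degree < k
        · simp [hdeg y hy]
        · have hx : x = 0 := by
            rw [← Finsupp.degree_eq_zero_iff]
            have := congrArg Finsupp.degree hxy
            simp only [map_add] at this
            omega
          subst hx
          simp [hc, constantCoeff_eq]
  rw [mem_iff_homogeneousComponent_mem hJ]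
  intro d
  obtain ⟨w, hw, hdeg⟩ := key (d + 1)
  have hw0 : homogeneousComponent d w = 0 :=
    homogeneousComponent_eq_zero' _ _ fun e he hed =>
      (mem_support_iff.1 he) (hdeg e (by omega))
  have := homogeneousComponent_mem_of_mem hJ hw d
  rwa [map_sub, hw0, sub_zero] at this

lemma isHomogeneous_ofList {l : List (MvPolynomial σ K)}
    (hl : ∀ p ∈ l, ∃ d, p.IsHomogeneous d) :
    (Ideal.ofList l).IsHomogeneous (homogeneousSubmodule σ K) :=
  Ideal.homogeneous_span _ _ fun p hp => hl p hp

lemma isHomogeneous_of_homogeneousComponent_mem {I : Ideal (MvPolynomial σ K)}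
    (h : ∀ p ∈ I, ∀ d, homogeneousComponent d p ∈ I) :
    I.IsHomogeneous (homogeneousSubmodule σ K) := by
  intro d p hp
  have := h p hp d
  rwa [← decomposition.decompose'_apply] at this

lemma isHomogeneous_ker_constantCoeff :
    (RingHom.ker (constantCoeff (R := K) (σ := σ))).IsHomogeneous (homogeneousSubmodule σ K) := by
  refine isHomogeneous_of_homogeneousComponent_mem fun p hp d => ?_
  rw [RingHom.mem_ker, constantCoeff_eq] at hp ⊢
  rw [coeff_homogeneousComponent, hp, ite_self]

/-- The complete intersection property descends along a retraction of polynomial rings which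
preserves the irrelevant ideals: if `I` is generated by a regular sequence and `J` is a retract of
`I` generated by homogeneous polynomials `g`, then some of the `g` form a regular sequence
generating `J`. -/
lemma exists_isRegular_sublist_of_retract {τ : Type*} [Finite σ] [Finite τ]
    (ι : MvPolynomial τ K →+* MvPolynomial σ K) (π : MvPolynomial σ K →+* MvPolynomial τ K)
    (hπι : ∀ p, π (ι p) = p) (hι : ∀ p d, p.IsHomogeneous d → (ι p).IsHomogeneous d)
    (hπ : ∀ p, constantCoeff p = 0 → constantCoeff (π p) = 0)
    {I : Ideal (MvPolynomial σ K)} {J : Ideal (MvPolynomial τ K)}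
    (hIJ : I.map π ≤ J) (hJI : J.map ι ≤ I)
    (hI : I.IsHomogeneous (homogeneousSubmodule σ K))
    {l : List (MvPolynomial σ K)} (hl : RingTheory.Sequence.IsRegular (MvPolynomial σ K) l)
    (hlI : Ideal.ofList l = I) {g : List (MvPolynomial τ K)} (hgJ : Ideal.ofList g = J)
    (hg : ∀ p ∈ g, ∃ d, p.IsHomogeneous d) :
    ∃ b, b.Sublist g ∧ RingTheory.Sequence.IsRegular (MvPolynomial τ K) b ∧ Ideal.ofList b = J := by
  set m : Ideal (MvPolynomial σ K) := RingHom.ker constantCoeff with hm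
  have hmhom : m.IsHomogeneous (homogeneousSubmodule σ K) := isHomogeneous_ker_constantCoeff
  have hmprime : m.IsPrime := RingHom.ker_isPrime _
  have hItop : I ≠ ⊤ := by
    rw [← hlI]
    simpa using hl.top_ne_smul.symm
  obtain ⟨b', hsub', hle, hirr⟩ := exists_sublist_irredundant (m * I) (g.map ι)
  obtain ⟨b, hsub, rfl⟩ := List.sublist_map_iff.1 hsub'
  have hbhom : ∀ p ∈ b, ∃ d, p.IsHomogeneous d := fun p hp => hg p (hsub.subset hp)
  have hbJ : ∀ p ∈ b, p ∈ J := fun p hp => hgJ ▸ Ideal.subset_span (hsub.subset hp)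
  have hιhom : ∀ s ⊆ b, (Ideal.ofList (s.map ι)).IsHomogeneous (homogeneousSubmodule σ K) := by
    refine fun s hs => isHomogeneous_ofList fun p hp => ?_
    obtain ⟨q, hq, rfl⟩ := List.mem_map.1 hp
    obtain ⟨d, hd⟩ := hbhom q (hs hq)
    exact ⟨d, hι q d hd⟩
  have hretract : ∀ s : List (MvPolynomial τ K), (Ideal.ofList (s.map ι)).map π =
      Ideal.ofList s := by
    intro s
    simp [Ideal.map_ofList, Function.comp_def, hπι]
  have hspan : Ideal.ofList b = J := by
    refine le_antisymm (Ideal.span_le.2 hbJ) ?_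
    have hJle : J ≤ Ideal.ofList b ⊔ RingHom.ker (constantCoeff (R := K) (σ := τ)) • J := by
      have h := Ideal.map_mono (f := π) hle
      rw [hretract, hgJ, Ideal.map_sup, hretract, Ideal.map_mul] at h
      rw [sup_comm]
      refine h.trans (sup_le_sup_right (Ideal.mul_mono ?_ hIJ) _)
      exact Ideal.map_le_iff_le_comap.2 fun p hp => hπ p hp
    obtain ⟨u, hu, huJ⟩ := Submodule.exists_sub_one_mem_and_smul_le_of_fg_of_le_sup
      (IsNoetherian.noetherian J) le_rfl hJle
    intro a ha
    refine mem_of_mul_mem_of_isHomogeneous (isHomogeneous_ofList hbhom) (u := u) ?_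
      (huJ (Submodule.smul_mem_pointwise_smul a u J ha))
    rw [RingHom.mem_ker, map_sub, map_one, sub_eq_zero] at hu
    simp [hu]
  refine ⟨b, hsub, ⟨?_, ?_⟩, hspan⟩
  · have hIm : I ≤ m := by
      intro u hu
      by_contra hum
      exact hItop ((Ideal.eq_top_iff_one _).2
        (mem_of_mul_mem_of_isHomogeneous hI (u := u) hum (by simpa using hu)))
    let R := Localization.AtPrime m
    have hcontr : ∀ (I' : Ideal (MvPolynomial σ K)),
        I'.IsHomogeneous (homogeneousSubmodule σ K) → ∀ x,
        algebraMap _ R x ∈ I'.map (algebraMap _ R) → x ∈ I' := by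
      intro I' hI' x hx
      obtain ⟨u, hu, hux⟩ :=
        (IsLocalization.algebraMap_mem_map_algebraMap_iff m.primeCompl R I' x).1 hx
      exact mem_of_mul_mem_of_isHomogeneous hI' hu hux
    have : IsNoetherianRing R := IsLocalization.isNoetherianRing m.primeCompl R inferInstance
    have hlR := hl.toIsWeaklyRegular.isRegular_of_isLocalization_of_mem R m
      (fun r hr => hIm (hlI ▸ Ideal.subset_span hr))
    have hlIR : Ideal.ofList (l.map (algebraMap _ R)) = I.map (algebraMap _ R) := by
      rw [← Ideal.map_ofList, hlI]
    obtain ⟨a', ha', -⟩ := IsLocalRing.exists_isRegular_append hlR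
      ((b.map ι).map (algebraMap _ R)) (by
        rw [hlIR]
        simp only [List.mem_map, forall_exists_index, and_imp, forall_apply_eq_imp_iff₂]
        exact fun p hp => Ideal.mem_map_of_mem _ (hJI (Ideal.mem_map_of_mem _ (hbJ p hp)))) (by
        intro x t hxt hx
        obtain ⟨s, hs, hst⟩ := List.suffix_map_iff.1 hxt
        obtain ⟨y, s', rfl, rfl, rfl⟩ := List.map_eq_cons_iff.1 hst.symm
        rw [hlIR, ← Localization.AtPrime.map_eq_maximalIdeal, ← Ideal.map_mul, ← Ideal.map_ofList,
          ← Ideal.map_sup] at hx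
        obtain ⟨s'', hs'', rfl⟩ := List.suffix_map_iff.1 ((List.suffix_cons y s').trans hs)
        exact hirr y _ hs (hcontr _ ((hmhom.mul hI).sup (hιhom s'' hs''.subset)) y hx))
    refine isWeaklyRegular_of_map ((algebraMap _ R).comp ι) (l := b) ?_ ?_
    · have := ((RingTheory.Sequence.isWeaklyRegular_append_iff _ _ _).1 ha'.toIsWeaklyRegular).1
      rwa [List.map_map] at this
    · intro s hs a ha
      have := hcontr _ (hιhom s hs.subset) (ι a) (by
        rwa [Ideal.map_ofList, List.map_map])
      have := Ideal.mem_map_of_mem π this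
      rwa [hretract, hπι] at this
  · rw [hspan, smul_eq_mul, Ideal.mul_top]
    intro h
    refine hItop ((Ideal.eq_top_iff_one _).2 (hJI ?_))
    rw [← map_one ι]
    exact Ideal.mem_map_of_mem ι (h ▸ Submodule.mem_top)

end MvPolynomial

section OrlikTerao

variable {ι : Type*}

/-- Clearing denominators when substituting the fractions `a i / g i` into a polynomial. -/
lemma MvPolynomial.exists_algHom_eq_prod_pow_mul_aeval_div.{u} {K : Type u} [Field K] [Fintype ι]
    {A : Type*} [CommRing A] [Algebra K A] (a g : ι → A) (p : MvPolynomial ι K) :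
    ∃ (N : ℕ) (q : A), ∀ (F : Type u) [Field F] [Algebra K F] (φ : A →ₐ[K] F),
      (∀ i, φ (g i) ≠ 0) →
        φ q = (∏ i, φ (g i)) ^ N * aeval (fun i => φ (a i) / φ (g i)) p := by
  classical
  induction p using MvPolynomial.induction_on with
  | C c => exact ⟨0, algebraMap K A c, fun F _ _ φ _ => by simp⟩
  | add p p' hp hp' =>
    obtain ⟨N, q, hq⟩ := hp
    obtain ⟨N', q', hq'⟩ := hp'
    refine ⟨N + N', q * (∏ i, g i) ^ N' + q' * (∏ i, g i) ^ N, fun F _ _ φ hφ => ?_⟩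
    rw [map_add, map_mul, map_mul, hq F φ hφ, hq' F φ hφ, map_pow, map_pow, map_prod, map_add]
    ring
  | mul_X p i hp =>
    obtain ⟨N, q, hq⟩ := hp
    refine ⟨N + 1, q * (a i * ∏ j ∈ Finset.univ.erase i, g j), fun F _ _ φ hφ => ?_⟩
    rw [map_mul, map_mul, hq F φ hφ, map_mul, aeval_X, map_prod, pow_succ,
      ← Finset.mul_prod_erase Finset.univ (fun j => φ (g j)) (Finset.mem_univ i)]
    field_simp [hφ i]

/-- Over an infinite field, membership in the Orlik–Terao ideal can be tested on the points of
the complement of the arrangement. -/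
lemma mem_otIdeal_iff_s15 [Infinite K] [Finite ι] {f : ι → MvPolynomial (Fin ℓ) K}
    (hne : ∀ i, f i ≠ 0) (p : MvPolynomial ι K) :
    p ∈ otIdeal f ↔ ∀ v : Fin ℓ → K, (∀ i, eval v (f i) ≠ 0) →
      eval (fun i => (eval v (f i))⁻¹) p = 0 := by
  have := Fintype.ofFinite ι
  obtain ⟨N, q, hq⟩ := exists_algHom_eq_prod_pow_mul_aeval_div (fun _ => 1) f p
  have hfrac : algebraMap (MvPolynomial (Fin ℓ) K) (RatFunField K ℓ) q =
      (∏ i, algebraMap (MvPolynomial (Fin ℓ) K) (RatFunField K ℓ) (f i)) ^ N * otMap f p := by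
    simpa [otMap] using hq _ (IsScalarTower.toAlgHom K _ (RatFunField K ℓ)) (by simpa using hne)
  have heval : ∀ v : Fin ℓ → K, (∀ i, eval v (f i) ≠ 0) →
      eval v q = (∏ i, eval v (f i)) ^ N * eval (fun i => (eval v (f i))⁻¹) p := by
    intro v hv
    simpa [aeval_eq_eval] using hq K (aeval v) (by simpa [aeval_eq_eval] using hv)
  change otMap f p = 0 ↔ _
  constructor
  · intro h v hv
    rw [h, mul_zero, map_eq_zero_iff _ (IsFractionRing.injective _ _)] at hfrac
    have := heval v hv
    rw [hfrac, map_zero, eq_comm, mul_eq_zero] at this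
    exact this.resolve_left (pow_ne_zero _ (Finset.prod_ne_zero_iff.2 fun i _ => hv i))
  · intro h
    have hq0 : q * ∏ i, f i = 0 := by
      refine MvPolynomial.funext fun v => ?_
      rw [map_mul, map_prod, map_zero, mul_eq_zero]
      by_cases hv : ∀ i, eval v (f i) ≠ 0
      · left
        rw [heval v hv, h v hv, mul_zero]
      · push Not at hv
        obtain ⟨i, hi⟩ := hv
        exact .inr (Finset.prod_eq_zero (Finset.mem_univ i) hi)
    have hq0 := (mul_eq_zero.1 hq0).resolve_right (Finset.prod_ne_zero_iff.2 fun i _ => hne i)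
    rw [hq0, map_zero, eq_comm, mul_eq_zero] at hfrac
    exact hfrac.resolve_left (pow_ne_zero _ (Finset.prod_ne_zero_iff.2 fun i _ => by
      simpa using hne i))

lemma MvPolynomial.IsHomogeneous.eval_smul {f : MvPolynomial ι K} {d : ℕ} (hf : f.IsHomogeneous d)
    (c : K) (v : ι → K) : eval (fun i => c * v i) f = c ^ d * eval v f := by
  rw [eval_eq, eval_eq, Finset.mul_sum]
  refine Finset.sum_congr rfl fun e he => ?_
  simp_rw [mul_pow]
  rw [Finset.prod_mul_distrib, Finset.prod_pow_eq_pow_sum, ← hf.degree_eq_sum_deg_support he]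
  ring

lemma MvPolynomial.IsHomogeneous.eval_add_of_one {f : MvPolynomial ι K} (hf : f.IsHomogeneous 1)
    (v w : ι → K) : eval (v + w) f = eval v f + eval w f := by
  rw [← mem_homogeneousSubmodule, homogeneousSubmodule_one_eq_span_X] at hf
  induction hf using Submodule.span_induction with
  | mem x hx =>
    obtain ⟨i, rfl⟩ := hx
    simp
  | zero => simp
  | add x y _ _ hx hy => simp only [map_add, hx, hy]; ring
  | smul a x _ hx => simp only [smul_eval, hx]; ring

/-- The Orlik–Terao ideal of a central arrangement is homogeneous. -/
lemma homogeneousComponent_mem_otIdeal [Infinite K] [Finite ι] {f : ι → MvPolynomial (Fin ℓ) K}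
    (hhom : ∀ i, (f i).IsHomogeneous 1) (hne : ∀ i, f i ≠ 0) {p : MvPolynomial ι K}
    (hp : p ∈ otIdeal f) (d : ℕ) : homogeneousComponent d p ∈ otIdeal f := by
  rw [mem_otIdeal_iff_s15 hne] at hp ⊢
  intro v hv
  set y : ι → K := fun i => (eval v (f i))⁻¹ with hy
  set P : Polynomial K := ∑ e ∈ Finset.range (p.totalDegree + 1),
    Polynomial.monomial e (eval y (homogeneousComponent e p)) with hP
  have hPeval : ∀ c : K, P.eval c = eval (fun i => c * y i) p := by
    intro c
    conv_rhs => rw [← sum_homogeneousComponent p]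
    rw [hP, Polynomial.eval_finsetSum, map_sum]
    refine Finset.sum_congr rfl fun e _ => ?_
    rw [Polynomial.eval_monomial, (homogeneousComponent_isHomogeneous e p).eval_smul, mul_comm]
  have hP0 : P * Polynomial.X = 0 := by
    refine Polynomial.funext fun c => ?_
    rw [Polynomial.eval_mul, Polynomial.eval_X, Polynomial.eval_zero, mul_eq_zero]
    refine or_iff_not_imp_right.2 fun hc => ?_
    have heval : ∀ i, eval (fun j => c⁻¹ * v j) (f i) = c⁻¹ * eval v (f i) := fun i => by
      rw [(hhom i).eval_smul, pow_one]
    have := hp (fun j => c⁻¹ * v j) fun i => by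
      rw [heval]
      exact mul_ne_zero (inv_ne_zero hc) (hv i)
    simp only [heval, mul_inv, inv_inv] at this
    rw [hPeval]
    exact this
  have hP0 := (mul_eq_zero.1 hP0).resolve_right Polynomial.X_ne_zero
  by_cases hd : p.totalDegree < d
  · rw [homogeneousComponent_eq_zero d p hd, map_zero]
  · have := congrArg (Polynomial.coeff · d) hP0
    simpa [hP, Polynomial.coeff_monomial, Nat.lt_succ_iff, not_lt.1 hd, hd] using this

/-- A flat contains a point which lies on no further hyperplane. -/
lemma exists_eval_eq_zero_iff_of_flat [Infinite K] [Finite ι] {f : ι → MvPolynomial (Fin ℓ) K}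
    (hhom : ∀ i, (f i).IsHomogeneous 1) (X : Set ι)
    (hflat : ∀ i, f i ∈ Submodule.span K (f '' X) → i ∈ X) :
    ∃ w : Fin ℓ → K, ∀ i, eval w (f i) = 0 ↔ i ∈ X := by
  let L : ι → Module.Dual K (Fin ℓ → K) := fun i =>
    { toFun := fun v => eval v (f i)
      map_add' := (hhom i).eval_add_of_one
      map_smul' := fun c v => by
        simpa [Pi.smul_def] using (hhom i).eval_smul c v }
  have hspan : ∀ h ∈ Submodule.span K (Set.range fun j : X => L j),
      ∃ q ∈ Submodule.span K (f '' X), ∀ v, eval v q = h v := by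
    intro h hh
    induction hh using Submodule.span_induction with
    | mem x hx =>
      obtain ⟨j, rfl⟩ := hx
      exact ⟨f j, Submodule.subset_span ⟨j, j.2, rfl⟩, fun v => rfl⟩
    | zero => exact ⟨0, zero_mem _, by simp⟩
    | add x y _ _ hx hy =>
      obtain ⟨q, hq, hqx⟩ := hx
      obtain ⟨r, hr, hry⟩ := hy
      exact ⟨q + r, add_mem hq hr, fun v => by simp [hqx, hry]⟩
    | smul a x _ hx =>
      obtain ⟨q, hq, hqx⟩ := hx
      exact ⟨a • q, Submodule.smul_mem _ a hq, fun v => by simp [hqx, smul_eval]⟩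
  obtain ⟨w, hw, hw'⟩ := Module.Dual.exists_forall_mem_ne_zero_of_forall_exists
    (⨅ j : X, LinearMap.ker (L j)) (fun i : (Xᶜ : Set ι) => L i) (by
      rintro ⟨i, hi⟩
      by_contra! h
      obtain ⟨q, hq, hqi⟩ := hspan (L i) (mem_span_of_iInf_ker_le_ker h)
      have : q = f i := MvPolynomial.funext hqi
      exact hi (hflat i (this ▸ hq)))
  refine ⟨w, fun i => ⟨fun h => ?_, fun h => ?_⟩⟩
  · by_contra hi
    exact hw' ⟨i, hi⟩ h
  · exact (Submodule.mem_iInf _).1 hw ⟨i, h⟩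

open scoped Classical in
/-- Setting the variables outside a flat to zero maps the Orlik–Terao ideal of an arrangement to
that of the corresponding subarrangement. -/
lemma aeval_mem_otIdeal_of_flat [Infinite K] [Finite ι] {f : ι → MvPolynomial (Fin ℓ) K}
    (hhom : ∀ i, (f i).IsHomogeneous 1) (hne : ∀ i, f i ≠ 0) (s : ι → Prop)
    (hflat : ∀ i, f i ∈ Submodule.span K (f '' {i | s i}) → s i) {p : MvPolynomial ι K}
    (hp : p ∈ otIdeal f) :
    aeval (fun i => if h : s i then X ⟨i, h⟩ else 0) p ∈ otIdeal (fun i : {j // s j} => f i) := by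
  have := Fintype.ofFinite ι
  rw [mem_otIdeal_iff_s15 hne] at hp
  rw [mem_otIdeal_iff_s15 (f := fun i : {j // s j} => f i) fun i => hne i]
  intro v hv
  obtain ⟨w, hw⟩ := exists_eval_eq_zero_iff_of_flat hhom {i | s i} hflat
  simp only [Set.mem_ofPred_eq] at hw
  let a : ι → Polynomial K := fun i => if s i then 1 else Polynomial.X
  let g : ι → Polynomial K := fun i =>
    if s i then Polynomial.C (eval v (f i))
    else Polynomial.X * Polynomial.C (eval v (f i)) + Polynomial.C (eval w (f i))
  have hg0 : ∀ i, (g i).eval 0 ≠ 0 := by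
    intro i
    by_cases hi : s i
    · simpa [g, hi] using hv ⟨i, hi⟩
    · simp [g, hi, hw]
  obtain ⟨N, q, hq⟩ := exists_algHom_eq_prod_pow_mul_aeval_div a g p
  have heval : ∀ t : K, (∀ i, (g i).eval t ≠ 0) →
      q.eval t = (∏ i, (g i).eval t) ^ N * eval (fun i => (a i).eval t / (g i).eval t) p := by
    intro t ht
    simpa [aeval_eq_eval, Polynomial.coe_aeval_eq_eval] using
      hq K (Polynomial.aeval t) (by simpa [Polynomial.coe_aeval_eq_eval] using ht)
  have hq0 : q * (Polynomial.X * ∏ i, g i) = 0 := by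
    refine Polynomial.funext fun t => ?_
    rw [Polynomial.eval_mul, Polynomial.eval_mul, Polynomial.eval_X, Polynomial.eval_prod,
      Polynomial.eval_zero, mul_eq_zero, mul_eq_zero]
    by_cases ht : t = 0
    · exact .inr (.inl ht)
    by_cases htg : ∀ i, (g i).eval t ≠ 0
    · left
      have hpt : ∀ i, (a i).eval t / (g i).eval t =
          (eval (v + fun j => t⁻¹ * w j) (f i))⁻¹ := by
        intro i
        rw [(hhom i).eval_add_of_one, (hhom i).eval_smul, pow_one]
        by_cases hi : s i
        · simp [a, g, hi, (hw i).2 hi]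
        · simp only [a, g, hi, if_false, Polynomial.eval_add, Polynomial.eval_mul,
            Polynomial.eval_X, Polynomial.eval_C]
          have : eval v (f i) + t⁻¹ * eval w (f i) =
              (t * eval v (f i) + eval w (f i)) / t := by field_simp
          rw [this, inv_div]
      have ha : ∀ i, (a i).eval t ≠ 0 := by
        intro i
        by_cases hi : s i <;> simp [a, hi, ht]
      rw [heval t htg, funext hpt, hp _ fun i => ?_, mul_zero]
      exact fun h => div_ne_zero (ha i) (htg i) (by rw [hpt, h, inv_zero])
    · push Not at htg
      obtain ⟨i, hi⟩ := htg
      exact .inr (.inr (Finset.prod_eq_zero (Finset.mem_univ i) hi))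
  have hq0 := (mul_eq_zero.1 hq0).resolve_right (mul_ne_zero Polynomial.X_ne_zero
    (Finset.prod_ne_zero_iff.2 fun i _ h => hg0 i (by simp [h])))
  have h0 := heval 0 hg0
  rw [hq0, Polynomial.eval_zero, eq_comm, mul_eq_zero] at h0
  have h0 := h0.resolve_left (pow_ne_zero _ (Finset.prod_ne_zero_iff.2 fun i _ => hg0 i))
  have hcomp : (aeval fun i : {j // s j} => (eval v (f i))⁻¹).comp
      (aeval fun i => if h : s i then X ⟨i, h⟩ else 0) =
      aeval (R := K) fun i => (a i).eval 0 / (g i).eval 0 := by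
    refine algHom_ext fun i => ?_
    by_cases hi : s i <;> simp [a, g, hi]
  rw [← h0]
  simpa [aeval_eq_eval] using DFunLike.congr_fun hcomp p

open scoped Classical in
lemma MvPolynomial.isHomogeneous_aeval_dite (s : ι → Prop) {p : MvPolynomial ι K} {d : ℕ}
    (hp : p.IsHomogeneous d) :
    (aeval (fun i => if h : s i then (X ⟨i, h⟩ : MvPolynomial {j // s j} K) else 0)
      p).IsHomogeneous d := by
  rw [← one_mul d]
  refine hp.aeval _ fun i => ?_
  split_ifs
  · exact isHomogeneous_X K _
  · exact isHomogeneous_zero _ _ _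

lemma map_rename_otIdeal_le (f : ι → MvPolynomial (Fin ℓ) K) (s : ι → Prop) :
    (otIdeal fun i : {j // s j} => f i).map (rename (R := K) ((↑) : {j // s j} → ι)) ≤
      otIdeal f := by
  refine Ideal.map_le_iff_le_comap.2 fun p hp => ?_
  change otMap f (rename _ p) = 0
  rw [otMap, aeval_rename]
  exact hp

open scoped Classical in
/-- If the Orlik–Terao ideal is generated by a regular sequence and also by the homogeneous
polynomials `g`, then some of the images of the `g` form a regular sequence generating the
Orlik–Terao ideal of the subarrangement of a flat. -/
lemma exists_isRegular_otIdeal_of_flat [Infinite K] [Finite ι] {f : ι → MvPolynomial (Fin ℓ) K}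
    (hhom : ∀ i, (f i).IsHomogeneous 1) (hne : ∀ i, f i ≠ 0) (s : ι → Prop)
    (hflat : ∀ i, f i ∈ Submodule.span K (f '' {i | s i}) → s i)
    {l : List (MvPolynomial ι K)} (hl : RingTheory.Sequence.IsRegular (MvPolynomial ι K) l)
    (hlI : Ideal.ofList l = otIdeal f)
    {g : List (MvPolynomial ι K)} (hg : ∀ p ∈ g, ∃ d, p.IsHomogeneous d)
    (hgI : Ideal.ofList g = otIdeal f) :
    ∃ b : List (MvPolynomial {j // s j} K),
      b ⊆ g.map (aeval fun i => if h : s i then X ⟨i, h⟩ else 0) ∧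
      RingTheory.Sequence.IsRegular (MvPolynomial {j // s j} K) b ∧
      Ideal.ofList b = otIdeal fun i : {j // s j} => f i := by
  set π : MvPolynomial ι K →ₐ[K] MvPolynomial {j // s j} K :=
    aeval fun i => if h : s i then X ⟨i, h⟩ else 0 with hπ
  let j : MvPolynomial {j // s j} K →ₐ[K] MvPolynomial ι K := rename (↑)
  have hπj : ∀ p, π (j p) = p := by
    intro p
    have : π.comp j = AlgHom.id K _ := algHom_ext fun i => by simp [π, j, i.2]
    exact DFunLike.congr_fun this p
  have hle : (otIdeal f).map π ≤ otIdeal fun i : {j // s j} => f i :=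
    Ideal.map_le_iff_le_comap.2 fun p hp => aeval_mem_otIdeal_of_flat hhom hne s hflat hp
  have hle' := map_rename_otIdeal_le f s
  have hgX : Ideal.ofList (g.map π) = otIdeal fun i : {j // s j} => f i := by
    have : Ideal.ofList (g.map π) = (otIdeal f).map π := by
      rw [← hgI]
      exact (Ideal.map_ofList π.toRingHom g).symm
    rw [this]
    refine le_antisymm hle fun p hp => ?_
    rw [← hπj p]
    exact Ideal.mem_map_of_mem π (hle' (Ideal.mem_map_of_mem _ hp))
  obtain ⟨b, hb, hreg, hspan⟩ := exists_isRegular_sublist_of_retract j.toRingHom π.toRingHom hπj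
    (fun p d hp => hp.rename_isHomogeneous) (fun p hp => by
      have : (constantCoeff.comp π.toRingHom : MvPolynomial ι K →+* K) = constantCoeff := by
        refine ringHom_ext (fun c => by simp) fun i => ?_
        by_cases hi : s i <;> simp [π, hi]
      rw [← hp]
      exact DFunLike.congr_fun this p) hle hle'
    (isHomogeneous_of_homogeneousComponent_mem fun p hp d =>
      homogeneousComponent_mem_otIdeal hhom hne hp d) hl hlI hgX (by
      simp only [List.mem_map, forall_exists_index, and_imp, forall_apply_eq_imp_iff₂]
      intro p hp
      obtain ⟨d, hd⟩ := hg p hp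
      exact ⟨d, isHomogeneous_aeval_dite s hd⟩)
  exact ⟨b, hb.subset, hreg, hspan⟩

end OrlikTerao

/-- if the Orlik–Terao ideal `I(A)` is a complete intersection,
then for every flat `X` the Orlik–Terao ideal `I(A_X)` of the closed
subarrangement `A_X` is a complete intersection; moreover if `I(A)` is a
quadratic complete intersection then so is `I(A_X)`. -/
theorem stmt15 [IsAlgClosed K]
    (f : Fin n → MvPolynomial (Fin ℓ) K)
    (hhom : ∀ i, (f i).IsHomogeneous 1) (hne : ∀ i, f i ≠ 0)
    (hdistinct : ∀ i j : Fin n, i ≠ j → ∀ a : K, f i ≠ a • f j)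
    (hessential : Module.finrank K (Submodule.span K (Set.range f)) = ℓ)
    (X : Finset (Fin n))
    (hflat : ∀ i : Fin n, f i ∈ Submodule.span K (f '' ↑X) → i ∈ X) :
    (IsCIdeal (otIdeal f) →
      IsCIdeal (otIdeal (fun i : {j : Fin n // j ∈ X} => f i))) ∧
    (IsQuadCIdeal (otIdeal f) →
      IsQuadCIdeal (otIdeal (fun i : {j : Fin n // j ∈ X} => f i))) := by
  have hflat' : ∀ i, f i ∈ Submodule.span K (f '' {i | i ∈ X}) → i ∈ X := hflat
  constructor
  · rintro ⟨l, hl, hlI⟩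
    let g := l.flatMap fun p =>
      (List.range (p.totalDegree + 1)).map fun d => homogeneousComponent d p
    have hgI : Ideal.ofList g = otIdeal f := by
      refine le_antisymm (Ideal.span_le.2 fun q hq => ?_) ?_
      · obtain ⟨p, hp, hq⟩ := List.mem_flatMap.1 hq
        obtain ⟨d, -, rfl⟩ := List.mem_map.1 hq
        exact homogeneousComponent_mem_otIdeal hhom hne (hlI ▸ Ideal.subset_span hp) d
      · rw [hlI, Ideal.span_le]
        intro p hp
        rw [← sum_homogeneousComponent p]
        exact sum_mem fun d hd => Ideal.subset_span
          (List.mem_flatMap.2 ⟨p, hp, List.mem_map.2 ⟨d, by simpa using hd, rfl⟩⟩)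
    obtain ⟨b, -, hreg, hspan⟩ := exists_isRegular_otIdeal_of_flat hhom hne (· ∈ X) hflat' hl
      hlI.symm (g := g) (fun q hq => by
        obtain ⟨p, hp, hq⟩ := List.mem_flatMap.1 hq
        obtain ⟨d, -, rfl⟩ := List.mem_map.1 hq
        exact ⟨d, homogeneousComponent_isHomogeneous d p⟩) hgI
    exact ⟨b, hreg, hspan.symm⟩
  · rintro ⟨l, hl, hl2, hlI⟩
    obtain ⟨b, hb, hreg, hspan⟩ := exists_isRegular_otIdeal_of_flat hhom hne (· ∈ X) hflat' hl
      hlI.symm (fun p hp => ⟨2, hl2 p hp⟩) hlI.symm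
    refine ⟨b, hreg, fun p hp => ?_, hspan.symm⟩
    obtain ⟨q, hq, rfl⟩ := List.mem_map.1 (hb hp)
    exact isHomogeneous_aeval_dite _ (hl2 q hq)
end
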